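/- arXiv:1010.3965 — 2 statements merged into one kernel-verified Lean document; each statement's English description precedes it below -/
import Mathlib

section
/- Let k be an even positive integer with k ≠ 6 and k not a power of 2, and let g_k(x,y) ∈ 𝔽₂[x,y] be the polynomial of degree k−2 with (x+y)(x+1)(y+1)·g_k(x,y) = x·y^k + y·x^k + x^k + y^k + x + y. If g_k(x,y) is irreducible in 𝔽₂[x,y], then g_k(x,y) is absolutely irreducible, i.e., irreducible as an element of K[x,y] for K an algebraic closure of 𝔽₂. -/
namespace GK
open Polynomial

/-- Bivariate polynomials `p(w)(X)` whose coefficient of `X^n` has degree at most `n` in `w`. -/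
def WD (K : Type*) [Field K] : Subring (K[X][X]) where
  carrier := {p | ∀ n, (p.coeff n).natDegree ≤ n}
  mul_mem' := by
    intro p r hp hr n
    rw [coeff_mul]
    refine natDegree_sum_le_of_forall_le _ _ ?_
    intro x hx
    have := Finset.HasAntidiagonal.mem_antidiagonal.1 hx
    refine natDegree_mul_le.trans ?_
    have h1 := hp x.1
    have h2 := hr x.2
    omega
  one_mem' := by
    intro n
    rw [coeff_one]; split_ifs <;> simp
  add_mem' := by
    intro p r hp hr n
    rw [coeff_add]
    exact (natDegree_add_le _ _).trans (max_le (hp n) (hr n))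
  zero_mem' := by intro n; simp
  neg_mem' := by intro p hp n; simpa using hp n

/-- substitution `x ↦ ξ`, `y ↦ η`. -/
noncomputable def pen {K : Type*} [Field K] (ξ η : K[X][X]) : K[X][X] →+* K[X][X] :=
  eval₂RingHom (eval₂RingHom (C.comp C) ξ) η

variable {K : Type*} [Field K]

@[simp] lemma pen_x (ξ η : K[X][X]) : pen ξ η (C X) = ξ := by simp [pen]
@[simp] lemma pen_y (ξ η : K[X][X]) : pen ξ η X = η := by simp [pen]
@[simp] lemma pen_c (ξ η : K[X][X]) (a : K) : pen ξ η (C (C a)) = C (C a) := by simp [pen]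

lemma C_C_mem (a : K) : (C (C a) : K[X][X]) ∈ WD K := by
  intro n; rw [coeff_C]; split_ifs <;> simp

lemma X_mem : (X : K[X][X]) ∈ WD K := by
  intro n; rw [coeff_X]; split_ifs <;> simp

lemma wX_mem : (C X * X : K[X][X]) ∈ WD K := by
  intro n; rw [coeff_C_mul, coeff_X]; split_ifs with h
  · subst h; simp
  · simp

lemma pen_mem {ξ η : K[X][X]} (hξ : ξ ∈ WD K) (hη : η ∈ WD K) (p : K[X][X]) :
    pen ξ η p ∈ WD K := by
  induction p using Polynomial.induction_on' with
  | add p r hp hr => rw [map_add]; exact add_mem hp hr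
  | monomial n a =>
    rw [← C_mul_X_pow_eq_monomial, map_mul, map_pow, pen_y]
    refine mul_mem ?_ (pow_mem hη n)
    induction a using Polynomial.induction_on' with
    | add p r hp hr => rw [C_add, map_add]; exact add_mem hp hr
    | monomial l c =>
      rw [← C_mul_X_pow_eq_monomial, C_mul, C_pow, map_mul, map_pow, pen_x, pen_c]
      exact mul_mem (C_C_mem c) (pow_mem hξ l)

lemma exists_trailing {p : K[X][X]} (hp : p ≠ 0) :
    ∃ i p', p = X ^ i * p' ∧ p'.coeff 0 ≠ 0 := by
  obtain ⟨r, hr, h⟩ := exists_eq_pow_rootMultiplicity_mul_and_not_dvd p hp 0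
  refine ⟨_, r, by simpa using hr, ?_⟩
  rw [C_0, sub_zero, X_dvd_iff] at h
  exact h

lemma X_pow_cancel {i j : ℕ} {p r : K[X][X]} (hp : p.coeff 0 ≠ 0) (hr : r.coeff 0 ≠ 0)
    (h : X ^ i * p = X ^ j * r) : i = j := by
  have key : ∀ {i j : ℕ} {p r : K[X][X]}, p.coeff 0 ≠ 0 →
    X ^ i * p = X ^ j * r → ¬ i < j := by
    intro i j p r hp h hij
    have := congrArg (fun s => coeff s i) h
    simp only [coeff_X_pow_mul'] at this
    rw [if_pos le_rfl, if_neg (by omega), Nat.sub_self] at this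
    exact hp this
  have h1 := key hp h
  have h2 := key hr h.symm
  omega

lemma dvd_linear_pow {c w0 : K} (hc : c ≠ 0) {q : ℕ} {A B : K[X]}
    (h : A * B = C c * (X + C w0) ^ q) :
    ∃ e1 e2 c1 c2, e1 + e2 = q ∧ c1 ≠ 0 ∧ c2 ≠ 0 ∧ A = C c1 * (X + C w0) ^ e1 ∧
      B = C c2 * (X + C w0) ^ e2 := by
  have hpr : Prime (X + C w0) := by
    have := prime_X_sub_C (-w0); simpa using this
  have hu : IsUnit (C c : K[X]) := isUnit_C.2 hc.isUnit
  have key : ∀ A : K[X], A ∣ C c * (X + C w0) ^ q → ∃ e c1, c1 ≠ 0 ∧ A = C c1 * (X + C w0) ^ e := by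
    intro A hA
    rw [hu.dvd_mul_left] at hA
    obtain ⟨e, _, he⟩ := (dvd_prime_pow hpr q).1 hA
    obtain ⟨v, hv⟩ := he.symm
    obtain ⟨c1, hc1, hc1'⟩ := Polynomial.isUnit_iff.1 v.isUnit
    exact ⟨e, c1, hc1.ne_zero, by rw [← hv, ← hc1', mul_comm]⟩
  obtain ⟨e1, c1, hc1, hA⟩ := key A (Dvd.intro _ h)
  obtain ⟨e2, c2, hc2, hB⟩ := key B (Dvd.intro_left _ h)
  refine ⟨e1, e2, c1, c2, ?_, hc1, hc2, hA, hB⟩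
  have := congrArg natDegree h
  rw [hA, hB, show C c1 * (X + C w0) ^ e1 * (C c2 * (X + C w0) ^ e2) =
    C (c1 * c2) * (X + C w0) ^ (e1 + e2) by rw [C_mul]; ring] at this
  rw [natDegree_C_mul (mul_ne_zero hc1 hc2), natDegree_C_mul hc, natDegree_pow, natDegree_pow,
    natDegree_X_add_C] at this
  omega

lemma local_factor {q : ℕ} {c w0 : K} (hc : c ≠ 0) {G : K[X]} {r u v : K[X][X]}
    (hu : u ∈ WD K) (hv : v ∈ WD K)
    (h : u * v = X ^ q * (C (C c * (X + C w0) ^ q) + X * C G + X ^ 2 * r)) :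
    ∃ i j c1 c2, i + j = q ∧ c1 ≠ 0 ∧ c2 ≠ 0 ∧ u.coeff i = C c1 * (X + C w0) ^ i ∧
      v.coeff j = C c2 * (X + C w0) ^ j ∧ (X + C w0) ^ (min i j) ∣ G ∧ X ^ i ∣ u ∧ X ^ j ∣ v := by
  have hne : (C c * (X + C w0) ^ q : K[X]) ≠ 0 :=
    mul_ne_zero (C_ne_zero.2 hc) (pow_ne_zero _ (X_add_C_ne_zero _))
  have h0 : (C (C c * (X + C w0) ^ q) + X * C G + X ^ 2 * r).coeff 0 = C c * (X + C w0) ^ q := by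
    simp [mul_coeff_zero, -map_mul, -map_pow]
  have hR : (C (C c * (X + C w0) ^ q) + X * C G + X ^ 2 * r) ≠ 0 := by
    intro hz; rw [hz] at h0; exact hne (by simpa using h0.symm)
  have huv : u * v ≠ 0 := by
    rw [h]; exact mul_ne_zero (pow_ne_zero _ X_ne_zero) hR
  obtain ⟨i, u', rfl, hu'⟩ := exists_trailing (left_ne_zero_of_mul huv)
  obtain ⟨j, v', rfl, hv'⟩ := exists_trailing (right_ne_zero_of_mul huv)
  have h2 : X ^ (i + j) * (u' * v') =
      X ^ q * (C (C c * (X + C w0) ^ q) + X * C G + X ^ 2 * r) := by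
    rw [← h]; ring
  have hij : i + j = q := X_pow_cancel
    (by rw [mul_coeff_zero]; exact mul_ne_zero hu' hv') (by rw [h0]; exact hne) h2
  rw [hij] at h2
  have h3 := mul_left_cancel₀ (pow_ne_zero _ X_ne_zero) h2
  have h4 := congrArg (fun s => coeff s 0) h3
  rw [h0, mul_coeff_zero] at h4
  obtain ⟨e1, e2, c1, c2, he, hc1, hc2, hA, hB⟩ := dvd_linear_pow hc h4
  have hi := hu i
  have hj := hv j
  rw [coeff_X_pow_mul', if_pos le_rfl, Nat.sub_self] at hi hj
  rw [hA, natDegree_C_mul hc1, natDegree_pow, natDegree_X_add_C, mul_one] at hi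
  rw [hB, natDegree_C_mul hc2, natDegree_pow, natDegree_X_add_C, mul_one] at hj
  obtain rfl : e1 = i := by omega
  obtain rfl : e2 = j := by omega
  refine ⟨e1, e2, c1, c2, he, hc1, hc2, ?_, ?_, ?_, Dvd.intro _ rfl, Dvd.intro _ rfl⟩
  · rw [coeff_X_pow_mul', if_pos le_rfl, Nat.sub_self, hA]
  · rw [coeff_X_pow_mul', if_pos le_rfl, Nat.sub_self, hB]
  · have h5 := congrArg (fun s => coeff s 1) h3
    have h6 : (C (C c * (X + C w0) ^ q) + X * C G + X ^ 2 * r).coeff 1 = G := by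
      rw [coeff_add, coeff_add, coeff_C_of_ne_zero one_ne_zero, coeff_X_mul,
        coeff_X_pow_mul']
      simp
    rw [h6, coeff_mul, Finset.Nat.antidiagonal_succ] at h5
    simp only [Finset.Nat.antidiagonal_zero, Finset.map_singleton, Finset.sum_cons,
      Finset.sum_singleton] at h5
    simp at h5
    rw [← h5]
    refine dvd_add ?_ ?_
    · rw [hA]
      exact Dvd.dvd.mul_right (Dvd.dvd.mul_left (pow_dvd_pow _ (min_le_left _ _)) _) _
    · rw [hB]
      exact Dvd.dvd.mul_left (Dvd.dvd.mul_left (pow_dvd_pow _ (min_le_right _ _)) _) _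

lemma pow_expand {R : Type*} [CommRing R] [CharP R 2] (t : ℕ) {m : ℕ} (hm : Odd m) (α ξ : R) :
    ∃ r, (α + ξ) ^ (2 ^ t * m) =
      α ^ (2 ^ t * m) + (α ^ (2 ^ t)) ^ (m - 1) * ξ ^ (2 ^ t) + ξ ^ (2 * 2 ^ t) * r := by
  obtain ⟨r, hr⟩ := Polynomial.powAddExpansion (α ^ (2 ^ t)) (ξ ^ (2 ^ t)) m
  have : Fact (Nat.Prime 2) := ⟨Nat.prime_two⟩
  have hm1 : (m : R) = 1 := by
    obtain ⟨l, rfl⟩ := hm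
    have : (2 : R) = 0 := CharTwo.two_eq_zero
    push_cast; rw [this]; ring
  refine ⟨r, ?_⟩
  rw [pow_mul, add_pow_char_pow, hr, hm1, pow_mul α]
  ring

end GK

namespace GK
open Polynomial
variable {K : Type*} [Field K]

lemma ord_le {a b c1 w0 : K} {i : ℕ} (hc1 : c1 ≠ 0) {u : K[X][X]} (hu0 : u.map (evalRingHom a) ≠ 0)
    (h : (pen (C (C a) + X) (C (C b) + C X * X) u).coeff i = C c1 * (X + C w0) ^ i) :
    rootMultiplicity b (u.map (evalRingHom a)) ≤ i := by
  by_contra hlt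
  push Not at hlt
  obtain ⟨p, hp⟩ := (le_rootMultiplicity_iff hu0).1 (Nat.succ_le_of_lt hlt)
  have hd : C (X - C a) ∣ u - (u.map (evalRingHom a)).map C := by
    rw [C_dvd_iff_dvd_coeff]
    intro n
    rw [coeff_sub, coeff_map, coeff_map, dvd_iff_isRoot]
    simp
  obtain ⟨r, hr⟩ := hd
  have hu : u = C (X - C a) * r + (X - C (C b)) ^ (i + 1) * p.map C := by
    rw [← hr, hp]; simp [Polynomial.map_mul]
  have h2 : pen (C (C a) + X) (C (C b) + C X * X) u =
      X * pen (C (C a) + X) (C (C b) + C X * X) r +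
      X ^ (i + 1) * (C (X ^ (i+1)) * pen (C (C a) + X) (C (C b) + C X * X) (p.map C)) := by
    conv_lhs => rw [hu]
    rw [C_sub]
    simp only [map_add, map_mul, map_sub, pen_x, pen_y, pen_c, map_pow]
    ring
  rw [h2, coeff_add, coeff_X_pow_mul', if_neg (by omega), add_zero] at h
  have hm := pen_mem (add_mem (C_C_mem a) X_mem) (add_mem (C_C_mem b) wX_mem) r
  have hdeg : (C c1 * (X + C w0) ^ i).natDegree = i := by
    rw [natDegree_C_mul hc1, natDegree_pow, natDegree_X_add_C, mul_one]
  cases i with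
  | zero =>
    rw [mul_coeff_zero, coeff_X_zero, zero_mul, pow_zero, mul_one] at h
    exact hc1 (C_eq_zero.1 h.symm)
  | succ i =>
    rw [coeff_X_mul] at h
    have := hm i
    rw [h, hdeg] at this
    omega

variable [CharP K 2]

instance charTwoA : CharP K[X] 2 := inferInstance
instance charTwoB : CharP K[X][X] 2 := inferInstance

/-- the polynomial `f` (already rewritten). -/
noncomputable def F (K : Type*) [Field K] (k : ℕ) : K[X][X] :=
  (C X + 1) * (X ^ k + 1) + (X + 1) * (C X ^ k + 1)

lemma two_q {t : ℕ} (ht : t ≠ 0) : ∃ s, 2 ^ t = s + 2 := by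
  have : 2 ^ 1 ≤ 2 ^ t := Nat.pow_le_pow_right (by norm_num) (Nat.pos_of_ne_zero ht)
  exact ⟨2 ^ t - 2, by omega⟩

lemma F_pen {t m : ℕ} (ht : t ≠ 0) (hm : Odd m) {a b : K} (ha : a ^ m = 1) (hb : b ^ m = 1)
    (ξ η : K[X]) : 
    ∃ r, pen (C (C a) + C ξ * X) (C (C b) + C η * X) (F K (2 ^ t * m)) =
      X ^ (2 ^ t) * (C (C ((a + 1) * (b ^ 2 ^ t) ^ (m - 1)) * η ^ (2 ^ t) +
        C ((b + 1) * (a ^ 2 ^ t) ^ (m - 1)) * ξ ^ (2 ^ t))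
        + X * C (C ((b ^ 2 ^ t) ^ (m - 1)) * ξ * η ^ (2 ^ t) +
            C ((a ^ 2 ^ t) ^ (m - 1)) * η * ξ ^ (2 ^ t)) + X ^ 2 * r) := by
  obtain ⟨r1, h1⟩ := pow_expand t hm (C (C a) : K[X][X]) (C ξ * X)
  obtain ⟨r2, h2⟩ := pow_expand t hm (C (C b) : K[X][X]) (C η * X)
  have hA : (C (C a) : K[X][X]) ^ (2 ^ t * m) = 1 := by
    rw [mul_comm, pow_mul, show (C (C a) : K[X][X]) ^ m = C (C (a ^ m)) by simp, ha]; simp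
  have hB : (C (C b) : K[X][X]) ^ (2 ^ t * m) = 1 := by
    rw [mul_comm, pow_mul, show (C (C b) : K[X][X]) ^ m = C (C (b ^ m)) by simp, hb]; simp
  have e2 : ((1 : K[X][X]) + 1) = 0 := CharTwo.add_self_eq_zero 1
  simp only [F, map_add, map_mul, map_pow, pen_x, pen_y, map_one, h1, h2, hA, hB]
  obtain ⟨s, hs⟩ := two_q ht
  rw [hs]
  refine ⟨(C (C a) + C ξ * X + 1) * C η ^ (2 * (s + 2)) * X ^ s * r2 +
    (C (C b) + C η * X + 1) * C ξ ^ (2 * (s + 2)) * X ^ s * r1, ?_⟩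
  linear_combination ((C (C a) + C ξ * X + 1) + (C (C b) + C η * X + 1)) * e2

lemma not_sq_dvd {t : ℕ} (ht : t ≠ 0) {A B w0 : K} (hB : B ≠ 0) :
    ¬ (X + C w0) ^ 2 ∣ (C A * X ^ (2 ^ t) + C B * X : K[X]) := by
  rintro ⟨p, hp⟩
  have h := congrArg derivative hp
  have h2 : ((2 : ℕ) : K[X]) = 0 := by exact_mod_cast CharTwo.two_eq_zero
  have h3 : ((2 ^ t : ℕ) : K[X]) = 0 := by
    push_cast; rw [CharTwo.two_eq_zero, zero_pow ht]
  rw [derivative_add, derivative_C_mul, derivative_X_pow, derivative_C_mul, derivative_X,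
    derivative_mul, derivative_pow] at h
  have h4 : C B = (X + C w0) ^ 2 * derivative p := by
    have e : (C ((2:ℕ) : K) : K[X]) = 0 := by
      rw [Nat.cast_ofNat, CharTwo.two_eq_zero, C_0]
    have e' : (C ((2 ^ t : ℕ) : K) : K[X]) = 0 := by
      rw [Nat.cast_pow, Nat.cast_ofNat, CharTwo.two_eq_zero, zero_pow ht, C_0]
    rw [e, e'] at h
    simpa using h
  have := congrArg (eval w0) h4
  simp only [eval_C, eval_mul, eval_pow, eval_add, eval_X, CharTwo.add_self_eq_zero] at this
  exact hB (by simpa using this)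

variable [IsAlgClosed K]

lemma ptA {t m : ℕ} (ht : t ≠ 0) (hm : Odd m) {a b : K} (ha : a ^ m = 1) (hb : b ^ m = 1)
    (ha1 : a ≠ 1) {u v : K[X][X]} (huv : u * v = F K (2 ^ t * m))
    (hu0 : u.map (evalRingHom a) ≠ 0) (hv0 : v.map (evalRingHom a) ≠ 0) :
    min (rootMultiplicity b (u.map (evalRingHom a))) (rootMultiplicity b (v.map (evalRingHom a))) ≤ 1
    ∧ (t = 1 → 1 ≤ min (rootMultiplicity b (u.map (evalRingHom a)))
        (rootMultiplicity b (v.map (evalRingHom a))) → b = 1 ∨ a = b ∨ a * b + a + b = 0) := by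
  have hm0 : m ≠ 0 := by rintro rfl; simp at hm
  have : Fact (Nat.Prime 2) := ⟨Nat.prime_two⟩
  have a0 : a ≠ 0 := by rintro rfl; simp [hm0] at ha
  have b0 : b ≠ 0 := by rintro rfl; simp [hm0] at hb
  set a' := (a ^ 2 ^ t) ^ (m - 1) with ha'
  set b' := (b ^ 2 ^ t) ^ (m - 1) with hb'
  have a'0 : a' ≠ 0 := pow_ne_zero _ (pow_ne_zero _ a0)
  have b'0 : b' ≠ 0 := pow_ne_zero _ (pow_ne_zero _ b0)
  have a11 : a + 1 ≠ 0 := fun h => ha1 (CharTwo.add_eq_zero.1 h)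
  have c0 : (a + 1) * b' ≠ 0 := mul_ne_zero a11 b'0
  obtain ⟨w0, hw0⟩ := IsAlgClosed.exists_pow_nat_eq ((b + 1) * a' / ((a + 1) * b'))
    (n := 2 ^ t) (by positivity)
  obtain ⟨r, hr⟩ := F_pen ht hm ha hb 1 X
  have hfac : (C ((a + 1) * b') * X ^ 2 ^ t + C ((b + 1) * a') * 1 ^ 2 ^ t : K[X]) =
      C ((a + 1) * b') * (X + C w0) ^ (2 ^ t) := by
    rw [add_pow_char_pow, ← C_pow, hw0, mul_add, ← C_mul, mul_div_cancel₀ _ c0]; simp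
  have hxi : (C (C a) + C 1 * X : K[X][X]) = C (C a) + X := by simp
  rw [← huv, ← ha', ← hb', hfac, map_mul, hxi] at hr
  have mem := fun p => pen_mem (add_mem (C_C_mem a) X_mem) (add_mem (C_C_mem b) wX_mem) p
  obtain ⟨i, j, c1, c2, hij, hc1, hc2, hi, hj, hG, -, -⟩ :=
    local_factor c0 (mem u) (mem v) hr
  have hui := ord_le hc1 hu0 hi
  have hvj := ord_le hc2 hv0 hj
  have hle : min (rootMultiplicity b (u.map (evalRingHom a)))
    (rootMultiplicity b (v.map (evalRingHom a))) ≤ min i j := min_le_min hui hvj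
  have hGe : (C b' * 1 * X ^ 2 ^ t + C a' * X * 1 ^ 2 ^ t : K[X]) = C b' * X ^ 2 ^ t + C a' * X := by
    simp
  rw [hGe] at hG
  refine ⟨?_, ?_⟩
  · refine hle.trans ?_
    by_contra hcon
    push Not at hcon
    exact not_sq_dvd ht a'0 ((pow_dvd_pow _ hcon).trans hG)
  · rintro rfl h1
    have hd : (X + C w0) ∣ (C b' * X ^ 2 ^ 1 + C a' * X : K[X]) :=
      (dvd_pow_self _ (by omega)).trans hG
    obtain ⟨p, hp⟩ := hd
    have he := congrArg (eval w0) hp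
    simp only [eval_C, eval_mul, eval_pow, eval_add, eval_X, CharTwo.add_self_eq_zero, pow_one,
      zero_mul] at he
    rw [pow_one, eq_div_iff c0] at hw0
    by_cases hw : w0 = 0
    · left
      rw [hw] at hw0
      have : (b + 1) * a' = 0 := by rw [← hw0]; ring
      rcases mul_eq_zero.1 this with h | h
      · exact CharTwo.add_eq_zero.1 h
      · exact absurd h a'0
    · right
      have h1 : b' * w0 = a' := by
        have : w0 * (b' * w0 + a') = 0 := by rw [← he]; ring
        rcases mul_eq_zero.1 this with h | h
        · exact absurd h hw
        · exact CharTwo.add_eq_zero.1 h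
      have hA : a' * a ^ 2 = 1 := by
        rw [ha', pow_one, ← pow_succ, Nat.sub_add_cancel (Nat.pos_of_ne_zero hm0), ← pow_mul,
          mul_comm, pow_mul, ha, one_pow]
      have hB : b' * b ^ 2 = 1 := by
        rw [hb', pow_one, ← pow_succ, Nat.sub_add_cancel (Nat.pos_of_ne_zero hm0), ← pow_mul,
          mul_comm, pow_mul, hb, one_pow]
      have h2 : b' * (b + 1) = a' * (a + 1) := by
        apply mul_left_cancel₀ a'0
        have : a' * (b' * (b + 1)) = b' * (w0 ^ 2 * ((a + 1) * b')) := by rw [hw0]; ring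
        rw [this, ← h1]; ring
      have h3 : a ^ 2 * (b + 1) = b ^ 2 * (a + 1) := by
        linear_combination (a ^ 2 * b ^ 2) * h2 - (a ^ 2 * (b + 1)) * hB + (b ^ 2 * (a + 1)) * hA
      have h4 : (a + b) * (a * b + a + b) = 0 := by
        have e2 : (2 : K) = 0 := CharTwo.two_eq_zero
        linear_combination h3 + (a * b ^ 2 + b ^ 2 + a * b) * e2
      rcases mul_eq_zero.1 h4 with h | h
      · exact Or.inl (CharTwo.add_eq_zero.1 h)
      · exact Or.inr h

lemma ptB {t m : ℕ} (ht : t ≠ 0) (hm : Odd m) {b : K} (hb : b ^ m = 1) (hb1 : b ≠ 1)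
    {u v : K[X][X]}
    (huv : (C X + X) * (C X + 1) * (X + 1) * (u * v) = F K (2 ^ t * m)) :
    (u.map (evalRingHom 1)).eval b ≠ 0 ∨ (v.map (evalRingHom 1)).eval b ≠ 0 := by
  have b11 : b + 1 ≠ 0 := fun h => hb1 (CharTwo.add_eq_zero.1 h)
  have hc : (b + 1) * (1 ^ 2 ^ t) ^ (m - 1) ≠ 0 := by simpa using b11
  obtain ⟨r, hr⟩ := F_pen ht hm (one_pow m : (1 : K) ^ m = 1) hb X 1
  have hfac : (C ((1 + 1) * (b ^ 2 ^ t) ^ (m - 1)) * 1 ^ 2 ^ t +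
      C ((b + 1) * (1 ^ 2 ^ t) ^ (m - 1)) * X ^ 2 ^ t : K[X]) =
      C ((b + 1) * (1 ^ 2 ^ t) ^ (m - 1)) * (X + C 0) ^ (2 ^ t) := by
    rw [CharTwo.add_self_eq_zero]; simp
  have hxi : (C (C b) + C 1 * X : K[X][X]) = C (C b) + X := by simp
  have hGe : (C ((b ^ 2 ^ t) ^ (m - 1)) * X * 1 ^ 2 ^ t + C ((1 ^ 2 ^ t) ^ (m - 1)) * 1 * X ^ 2 ^ t
     : K[X]) = C 1 * X ^ 2 ^ t + C ((b ^ 2 ^ t) ^ (m - 1)) * X := by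
    simp; ring
  have hm0 : m ≠ 0 := by rintro rfl; simp at hm
  have b0 : b ≠ 0 := by rintro rfl; simp [hm0] at hb
  have b'0 : (b ^ 2 ^ t) ^ (m - 1) ≠ 0 := pow_ne_zero _ (pow_ne_zero _ b0)
  rw [hfac, hxi, hGe] at hr
  have mem := fun p => pen_mem (add_mem (C_C_mem (1 : K)) wX_mem) (add_mem (C_C_mem b) X_mem) p
  set Φ := pen (C (C (1:K)) + C X * X) (C (C b) + X) with hΦ
  have hval : ∀ p : K[X][X], (Φ p).coeff 0 = C ((p.map (evalRingHom 1)).eval b) := by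
    intro p
    have : ((constantCoeff).comp Φ) = (C : K →+* K[X]).comp
        ((evalRingHom b).comp (mapRingHom (evalRingHom 1))) := by
      apply Polynomial.ringHom_ext'
      · apply Polynomial.ringHom_ext <;> simp [hΦ]
      · simp [hΦ]
    simpa using congrArg (fun g => g p) this
  have h1 : Φ ((C X + X) * (C X + 1) * (X + 1) * u) * Φ v = Φ (F K (2 ^ t * m)) := by
    rw [← huv, ← map_mul, mul_assoc _ u v]
  have h2 : Φ u * Φ ((C X + X) * (C X + 1) * (X + 1) * v) = Φ (F K (2 ^ t * m)) := by
    rw [← huv, ← map_mul, mul_left_comm]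
  rw [hr] at h1 h2
  obtain ⟨i1, j1, c1, c2, hij, hc1, hc2, hi, hj, hG, di, dj⟩ :=
    local_factor hc (mem _) (mem _) h1
  obtain ⟨i2, j2, d1, d2, hij', hd1, hd2, hi', hj', hG', di', dj'⟩ :=
    local_factor hc (mem _) (mem _) h2
  have n1 : min i1 j1 ≤ 1 := by
    by_contra hcon
    push Not at hcon
    exact not_sq_dvd ht b'0 ((pow_dvd_pow _ hcon).trans hG)
  have n2 : min i2 j2 ≤ 1 := by
    by_contra hcon
    push Not at hcon
    exact not_sq_dvd ht b'0 ((pow_dvd_pow _ hcon).trans hG')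
  have hq := two_q ht
  have hqe : Even (2 ^ t) := (even_two).pow_of_ne_zero ht
  by_cases hj0 : j1 = 0
  · right
    rw [hj0, hval] at hj
    intro h; rw [h] at hj
    simp at hj; exact hc2 (C_eq_zero.1 hj.symm)
  by_cases hi0 : i2 = 0
  · left
    rw [hi0, hval] at hi'
    intro h; rw [h] at hi'
    simp at hi'; exact hd1 (C_eq_zero.1 hi'.symm)
  exfalso
  have two2 : (1 : K[X][X]) + 1 = 0 := CharTwo.add_self_eq_zero 1
  have L1 : Φ (C X + 1) = X * C X := by
    simp only [hΦ, map_add, pen_x, map_one]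
    linear_combination two2
  obtain ⟨u', hu'⟩ := di'
  obtain ⟨v', hv'⟩ := dj
  have e1 : Φ ((C X + X) * (C X + 1) * (X + 1) * u) =
      X ^ (i2 + 1) * (C X * (Φ ((C X + X) * (X + 1)) * u')) := by
    rw [show (C X + X) * (C X + 1) * (X + 1) * u = (C X + X) * (X + 1) * ((C X + 1) * u) by ring,
      map_mul, map_mul _ (C X + 1) u, L1, hu']
    ring
  have e2 : Φ ((C X + X) * (C X + 1) * (X + 1) * v) =
      X ^ (j1 + 1) * (C X * (Φ ((C X + X) * (X + 1)) * v')) := by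
    rw [show (C X + X) * (C X + 1) * (X + 1) * v = (C X + X) * (X + 1) * ((C X + 1) * v) by ring,
      map_mul, map_mul _ (C X + 1) v, L1, hv']
    ring
  have ne1 : ∀ (c : K) (i : ℕ), c ≠ 0 → C c * (X + C 0) ^ i ≠ 0 := fun c i h =>
    mul_ne_zero (C_ne_zero.2 h) (pow_ne_zero _ (X_add_C_ne_zero _))
  have g1 : i2 + 1 ≤ i1 := by
    by_contra hcon
    rw [e1, coeff_X_pow_mul', if_neg hcon] at hi
    exact ne1 _ _ hc1 hi.symm
  have g2 : j1 + 1 ≤ j2 := by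
    by_contra hcon
    rw [e2, coeff_X_pow_mul', if_neg hcon] at hj'
    exact ne1 _ _ hd2 hj'.symm
  have g3 : i1 ≤ i2 + 1 := by
    by_contra hcon
    have hz := X_pow_dvd_iff.1 di (i2 + 1) (by omega)
    rw [e1, coeff_X_pow_mul', if_pos le_rfl, Nat.sub_self, mul_coeff_zero, mul_coeff_zero,
      hval] at hz
    rw [hu', coeff_X_pow_mul', if_pos le_rfl, Nat.sub_self] at hi'
    rw [hi'] at hz
    have : eval b ((((C X + X) * (X + 1) : K[X][X])).map (evalRingHom 1)) ≠ 0 := by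
      simp [Polynomial.map_mul, Polynomial.map_add]
      exact ⟨by rwa [add_comm], b11⟩
    refine mul_ne_zero ?_ (mul_ne_zero (C_ne_zero.2 this) (ne1 _ _ hd1)) hz
    simp
  obtain ⟨z, hz⟩ := hqe
  omega

end GK

namespace GK
open Polynomial Module
variable {K : Type*} [Field K]

/-- polynomials of total degree `< n`. -/
def T (K : Type*) [Field K] (n : ℕ) : Submodule K K[X][X] where
  carrier := {p | ∀ i j, n ≤ i + j → (p.coeff j).coeff i = 0}
  add_mem' := by
    intro p r hp hr i j h
    rw [coeff_add, coeff_add, hp i j h, hr i j h, add_zero]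
  zero_mem' := by intro i j h; simp
  smul_mem' := by
    intro c p hp i j h
    rw [coeff_smul, coeff_smul, hp i j h, smul_zero]

/-- index set -/
def S (n : ℕ) : Finset (Σ _ : ℕ, ℕ) := (Finset.range n).sigma (fun j => Finset.range (n - j))

lemma card_S (n : ℕ) : 2 * (S n).card = n * (n + 1) := by
  rw [S, Finset.card_sigma]
  simp only [Finset.card_range]
  induction n with
  | zero => simp
  | succ n ih =>
    rw [Finset.sum_range_succ', mul_add]
    simp only [Nat.add_sub_add_right]
    rw [ih]; simp; ring

lemma mem_S {n : ℕ} {x : Σ _ : ℕ, ℕ} : x ∈ S n ↔ x.1 + x.2 < n := by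
  simp [S]; omega

/-- coefficients -/
noncomputable def evT (K : Type*) [Field K] (n : ℕ) : T K n →ₗ[K] (S n → K) where
  toFun p x := (p.1.coeff x.1.1).coeff x.1.2
  map_add' := by intro p r; ext x; simp
  map_smul' := by intro p r; ext x; simp

lemma evT_bij (n : ℕ) : Function.Bijective (evT K n) := by
  constructor
  · intro p r h
    ext j i
    by_cases hij : j + i < n
    · exact congrFun h ⟨⟨j, i⟩, mem_S.2 hij⟩
    · rw [p.2 i j (by omega), r.2 i j (by omega)]
  · intro c
    have hco : ∀ j i, ((∑ x : S n, monomial x.1.1 (monomial x.1.2 (c x)) : K[X][X]).coeff j).coeff i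
        = if h : (⟨j, i⟩ : Σ _ : ℕ, ℕ) ∈ S n then c ⟨⟨j, i⟩, h⟩ else 0 := by
      intro j i
      rw [finsetSum_coeff, finsetSum_coeff]
      split_ifs with h
      · rw [Finset.sum_eq_single ⟨⟨j, i⟩, h⟩]
        · simp
        · rintro ⟨⟨j', i'⟩, h'⟩ _ hne
          rw [coeff_monomial]
          split_ifs with h1
          · rw [coeff_monomial, if_neg]
            intro h2
            apply hne
            simp only at h1 h2
            subst h1 h2; rfl
          · simp
        · simp
      · apply Finset.sum_eq_zero
        rintro ⟨⟨j', i'⟩, h'⟩ _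
        rw [coeff_monomial]
        split_ifs with h1
        · rw [coeff_monomial, if_neg]
          intro h2
          apply h
          simp only at h1 h2
          subst h1 h2; exact h'
        · simp
    refine ⟨⟨∑ x : S n, monomial x.1.1 (monomial x.1.2 (c x)), ?_⟩, ?_⟩
    · intro i j h
      rw [hco, dif_neg]
      rw [mem_S]; simp only; omega
    · ext ⟨⟨j, i⟩, h⟩
      change ((∑ x : S n, monomial x.1.1 (monomial x.1.2 (c x)) : K[X][X]).coeff j).coeff i = _
      rw [hco, dif_pos h]

/-- linear equivalence -/
noncomputable def eT (K : Type*) [Field K] (n : ℕ) : T K n ≃ₗ[K] (S n → K) :=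
  LinearEquiv.ofBijective (evT K n) (evT_bij n)

instance (n : ℕ) : FiniteDimensional K (T K n) := Module.Finite.equiv (eT K n).symm

lemma finrank_T (n : ℕ) : 2 * finrank K (T K n) = n * (n + 1) := by
  rw [(eT K n).finrank_eq, Module.finrank_fintype_fun_eq_card, Fintype.card_coe, card_S]

/-- homogenising substitution. -/
noncomputable abbrev Θ (K : Type*) [Field K] : K[X][X] →+* K[X][X] := pen X (C X * X)

lemma Θ_coeff (p : K[X][X]) (n l : ℕ) :
    ((Θ K p).coeff n).coeff l = if l ≤ n then (p.coeff l).coeff (n - l) else 0 := by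
  induction p using Polynomial.induction_on' with
  | add p r hp hr =>
    rw [map_add, coeff_add, coeff_add, hp, hr]
    split_ifs <;> simp
  | monomial j a =>
    induction a using Polynomial.induction_on' with
    | add p r hp hr =>
      rw [map_add, map_add, coeff_add, coeff_add, hp, hr]
      split_ifs <;> simp
    | monomial i c =>
      have : Θ K (monomial j (monomial i c)) = C (C c * X ^ j) * X ^ (i + j) := by
        rw [← C_mul_X_pow_eq_monomial, ← C_mul_X_pow_eq_monomial]
        simp only [map_mul, map_pow, pen_x, pen_y, pen_c]
        ring
      rw [this, coeff_C_mul_X_pow, coeff_monomial]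
      by_cases hn : n = i + j
      · subst hn
        rw [if_pos rfl, coeff_C_mul_X_pow]
        by_cases hl : l = j
        · subst hl; simp
        · rw [if_neg hl, if_neg (Ne.symm hl)]; simp
      · rw [if_neg hn]
        split_ifs with h1 h2
        · rw [coeff_monomial, if_neg (by omega), coeff_zero]
        · simp
        · simp

lemma mem_T_iff {p : K[X][X]} {n : ℕ} : p ∈ T K n ↔ (Θ K p).degree < n := by
  rw [degree_lt_iff_coeff_zero]
  constructor
  · intro h N hN
    ext l
    rw [Θ_coeff]
    split_ifs with hl
    · rw [h (N - l) l (by omega)]; simp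
    · simp
  · intro h i j hij
    have := congrArg (fun s => coeff s j) (h (i + j) hij)
    simp only [Θ_coeff, coeff_zero] at this
    rwa [if_pos (by omega), Nat.add_sub_cancel] at this

lemma key_T {u v : K[X][X]} {D1 D2 : ℕ} (hu : u.Monic) (hu1 : u.natDegree = D1)
    (hU : (Θ K u).natDegree = D1) (hV : (Θ K v).natDegree = D2)
    (hUd : (Θ K u).leadingCoeff.natDegree = D1) (hv0 : Θ K v ≠ 0)
    (hcop : IsCoprime (Θ K u).leadingCoeff (Θ K v).leadingCoeff)
    {p : K[X][X]} (hp : p ∈ T K (D1 + D2)) (hI : p ∈ Ideal.span {u, v}) :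
    ∃ α ∈ T K D2, ∃ β ∈ T K D1, p = α * u + β * v := by
  obtain ⟨α0, β0, h0⟩ := Ideal.mem_span_pair.1 hI
  have hu0 : Θ K u ≠ 0 := by
    intro h
    rw [h, leadingCoeff_zero] at hcop
    rw [h] at hU hUd
    simp at hU
    have : u = 1 := eq_one_of_monic_natDegree_zero hu (by omega)
    rw [this, map_one] at h
    exact one_ne_zero h
  set β := β0 %ₘ u with hβ
  set α := α0 + v * (β0 /ₘ u) with hα
  have hpe : p = α * u + β * v := by
    have := modByMonic_add_div β0 u
    rw [← h0]
    conv_lhs => rw [← this]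
    rw [hα, hβ]; ring
  rw [mem_T_iff] at hp
  have hΘ : Θ K p = Θ K α * Θ K u + Θ K β * Θ K v := by
    rw [hpe, map_add, map_mul, map_mul]
  have hdu : degree (Θ K u) = D1 := by rw [degree_eq_natDegree hu0, hU]
  have hdv : degree (Θ K v) = D2 := by rw [degree_eq_natDegree hv0, hV]
  have hβT : (Θ K β).degree < D1 := by
    by_contra hcon
    push Not at hcon
    have hB0 : Θ K β ≠ 0 := by
      intro h; rw [h, degree_zero] at hcon; simp at hcon
    have hBN : D1 ≤ (Θ K β).natDegree := le_natDegree_of_coe_le_degree hcon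
    have hlt : (Θ K p).degree < (Θ K β * Θ K v).degree := by
      refine hp.trans_le ?_
      rw [degree_mul, hdv, Nat.cast_add]
      gcongr
    have e : Θ K α * Θ K u = -(Θ K β * Θ K v) + Θ K p := by rw [hΘ]; ring
    have e2 := congrArg leadingCoeff e
    rw [leadingCoeff_add_of_degree_lt' (by rwa [degree_neg]), leadingCoeff_neg, leadingCoeff_mul,
      leadingCoeff_mul] at e2
    have hd : (Θ K u).leadingCoeff ∣ (Θ K β).leadingCoeff * (Θ K v).leadingCoeff :=
      ⟨-(Θ K α).leadingCoeff, by rw [mul_comm _ (-_), neg_mul, e2, neg_neg]⟩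
    have hd2 := hcop.dvd_of_dvd_mul_right hd
    have h3 := natDegree_le_of_dvd hd2 (leadingCoeff_ne_zero.2 hB0)
    rw [hUd] at h3
    have hne : (Θ K β).leadingCoeff ≠ 0 := leadingCoeff_ne_zero.2 hB0
    have hc : ((Θ K β).leadingCoeff).coeff ((Θ K β).leadingCoeff.natDegree) ≠ 0 := by
      rw [coeff_natDegree]; exact leadingCoeff_ne_zero.2 hne
    rw [leadingCoeff, Θ_coeff, ← leadingCoeff] at hc
    have hb : β.coeff ((Θ K β).leadingCoeff.natDegree) = 0 := by
      apply coeff_eq_zero_of_degree_lt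
      refine (degree_modByMonic_lt β0 hu).trans_le ?_
      rw [degree_eq_natDegree hu.ne_zero, hu1]
      exact_mod_cast h3
    rw [hb] at hc
    simp at hc
  refine ⟨α, ?_, β, mem_T_iff.2 hβT, hpe⟩
  rw [mem_T_iff]
  have e : Θ K α * Θ K u = Θ K p - Θ K β * Θ K v := by rw [hΘ]; ring
  have hlt : (Θ K α * Θ K u).degree < ((D1 + D2 : ℕ) : WithBot ℕ) := by
    rw [e]
    refine (degree_sub_le _ _).trans_lt (max_lt hp ?_)
    by_cases hB0 : Θ K β = 0
    · rw [hB0, zero_mul, degree_zero]; exact WithBot.bot_lt_coe _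
    · rw [degree_mul, hdv, degree_eq_natDegree hB0]
      rw [degree_eq_natDegree hB0] at hβT
      have : (Θ K β).natDegree < D1 := by exact_mod_cast hβT
      exact_mod_cast (by omega : (Θ K β).natDegree + D2 < D1 + D2)
  by_cases hA0 : Θ K α = 0
  · rw [hA0, degree_zero]; exact WithBot.bot_lt_coe _
  · rw [degree_mul, hdu, degree_eq_natDegree hA0] at hlt
    have : (Θ K α).natDegree + D1 < D1 + D2 := by exact_mod_cast hlt
    rw [degree_eq_natDegree hA0]
    exact_mod_cast (by omega : (Θ K α).natDegree < D2)

/-- `P/I` has dimension at most `n`. -/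
def Cod (I : Ideal K[X][X]) (n : ℕ) : Prop :=
  ∃ W : Submodule K K[X][X], FiniteDimensional K W ∧ finrank K W ≤ n ∧ ∀ p, ∃ w ∈ W, p - w ∈ I

lemma dim_aux {V : Type*} [AddCommGroup V] [Module K V] (I W T T1 T2 : Submodule K V)
    [FiniteDimensional K W] [FiniteDimensional K T] [FiniteDimensional K T1]
    [FiniteDimensional K T2] (φ ψ : V →ₗ[K] V)
    (hsp : ∀ p, ∃ w ∈ W, p - w ∈ I)
    (hk : ∀ p ∈ T, p ∈ I → ∃ α ∈ T1, ∃ β ∈ T2, p = φ α + ψ β) :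
    finrank K T ≤ finrank K W + (finrank K T1 + finrank K T2) := by
  have hle : T ≤ W ⊔ I := by
    intro p _
    obtain ⟨w, hw, h⟩ := hsp p
    exact Submodule.mem_sup.2 ⟨w, hw, p - w, h, by abel⟩
  let f := I.mkQ.domRestrict T
  have h1 : finrank K (LinearMap.range f) ≤ finrank K W := by
    have hle : LinearMap.range f ≤ W.map I.mkQ := by
      rintro _ ⟨p, rfl⟩
      obtain ⟨w, hw, hpw⟩ := hsp p.1
      refine ⟨w, hw, ?_⟩
      exact ((Submodule.Quotient.eq I).2 hpw).symm
    exact (Submodule.finrank_mono hle).trans (Submodule.finrank_map_le _ _)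
  have h2 : finrank K (LinearMap.ker f) ≤ finrank K T1 + finrank K T2 := by
    have hle : (LinearMap.ker f).map T.subtype ≤ T1.map φ ⊔ T2.map ψ := by
      rintro _ ⟨p, hp, rfl⟩
      have hpI : p.1 ∈ I := by
        have : I.mkQ p.1 = 0 := hp
        rw [Submodule.mkQ_apply, Submodule.Quotient.mk_eq_zero] at this
        exact this
      obtain ⟨α, hα, β, hβ, h⟩ := hk p.1 p.2 hpI
      rw [Submodule.subtype_apply, h]
      exact Submodule.add_mem_sup ⟨α, hα, rfl⟩ ⟨β, hβ, rfl⟩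
    have e1 := Submodule.finrank_map_subtype_eq T (LinearMap.ker f)
    rw [← e1]
    refine (Submodule.finrank_mono hle).trans
      ((Submodule.finrank_add_le_finrank_add_finrank _ _).trans ?_)
    exact add_le_add (Submodule.finrank_map_le _ _) (Submodule.finrank_map_le _ _)
  have h3 := LinearMap.finrank_range_add_finrank_ker f
  omega

lemma bezout {u v : K[X][X]} {D1 D2 : ℕ} (hu : u.Monic) (hu1 : u.natDegree = D1)
    (hU : (Θ K u).natDegree = D1) (hV : (Θ K v).natDegree = D2)
    (hUd : (Θ K u).leadingCoeff.natDegree = D1) (hv0 : Θ K v ≠ 0)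
    (hcop : IsCoprime (Θ K u).leadingCoeff (Θ K v).leadingCoeff)
    {N : ℕ} (hN : Cod (Ideal.span {u, v}) N) : D1 * D2 ≤ N := by
  obtain ⟨W, hW, hWN, hsp⟩ := hN
  have h3 := dim_aux ((Ideal.span {u, v}).restrictScalars K) W (T K (D1 + D2)) (T K D2) (T K D1)
    (LinearMap.mulRight K u) (LinearMap.mulRight K v) hsp
    (fun p hp hpI => key_T hu hu1 hU hV hUd hv0 hcop hp hpI)
  have t1 := finrank_T (K := K) D1
  have t2 := finrank_T (K := K) D2
  have t3 := finrank_T (K := K) (D1 + D2)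
  nlinarith

lemma Cod_mul {I : Ideal K[X][X]} {a b : K[X][X]} {n1 n2 : ℕ}
    (h1 : Cod (I ⊔ Ideal.span {a}) n1) (h2 : Cod (I ⊔ Ideal.span {b}) n2) :
    Cod (I ⊔ Ideal.span {a * b}) (n1 + n2) := by
  obtain ⟨W1, hW1, hn1, s1⟩ := h1
  obtain ⟨W2, hW2, hn2, s2⟩ := h2
  refine ⟨W1 ⊔ W2.map (LinearMap.mulLeft K a), inferInstance, ?_, ?_⟩
  · refine (Submodule.finrank_add_le_finrank_add_finrank _ _).trans ?_
    have := Submodule.finrank_map_le (LinearMap.mulLeft K a) W2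
    omega
  · intro p
    obtain ⟨w1, hw1, h1⟩ := s1 p
    obtain ⟨i1, hi1, x, hx, e1⟩ := Submodule.mem_sup.1 h1
    obtain ⟨y, rfl⟩ := Ideal.mem_span_singleton'.1 hx
    obtain ⟨w2, hw2, h2⟩ := s2 y
    obtain ⟨i2, hi2, x, hx, e2⟩ := Submodule.mem_sup.1 h2
    obtain ⟨z, rfl⟩ := Ideal.mem_span_singleton'.1 hx
    refine ⟨w1 + a * w2, Submodule.add_mem_sup hw1 ⟨w2, hw2, rfl⟩, ?_⟩
    have : p - (w1 + a * w2) = (i1 + a * i2) + z * (a * b) := by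
      linear_combination -e1 - a * e2
    rw [this]
    exact Submodule.add_mem_sup (add_mem hi1 (I.mul_mem_left a hi2))
      (Ideal.mem_span_singleton'.2 ⟨z, rfl⟩)

lemma Cod_one (I : Ideal K[X][X]) : Cod (I ⊔ Ideal.span {1}) 0 := by
  refine ⟨⊥, inferInstance, by simp, fun p => ⟨0, by simp, ?_⟩⟩
  simp

lemma Cod_prod {ι : Type*} (I : Ideal K[X][X]) (s : Finset ι) (a : ι → K[X][X]) (n : ι → ℕ)
    (h : ∀ i ∈ s, Cod (I ⊔ Ideal.span {a i}) (n i)) :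
    Cod (I ⊔ Ideal.span {∏ i ∈ s, a i}) (∑ i ∈ s, n i) := by
  classical
  induction s using Finset.induction_on with
  | empty => simpa using Cod_one I
  | insert i s hi ih =>
    rw [Finset.prod_insert hi, Finset.sum_insert hi]
    exact Cod_mul (h i (by simp)) (ih fun j hj => h j (by simp [hj]))

lemma Cod_pow (I : Ideal K[X][X]) (a : K[X][X]) (n q : ℕ) 
    (h : Cod (I ⊔ Ideal.span {a}) n) :
    Cod (I ⊔ Ideal.span {a ^ q}) (q * n) := by
  have := Cod_prod I (Finset.range q) (fun _ => a) (fun _ => n) (fun _ _ => h)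
  simpa using this

lemma Cod_base {u v : K[X][X]} (a : K) {d : K[X]} (hd : d ≠ 0)
    (hde : d ∈ Ideal.span {u.map (evalRingHom a), v.map (evalRingHom a)}) :
    Cod (Ideal.span {u, v} ⊔ Ideal.span {C X - C (C a)}) d.natDegree := by
  let ι : K[X] →ₗ[K] K[X][X] := (Polynomial.mapAlg K K[X]).toLinearMap
  have hι : ∀ p, ι p = p.map C := fun p => by
    simp [ι, mapAlg_eq_map]
  refine ⟨(degreeLT K d.natDegree).map ι, inferInstance, ?_, ?_⟩
  · refine (Submodule.finrank_map_le _ _).trans ?_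
    rw [(degreeLTEquiv K d.natDegree).finrank_eq]; simp
  · intro p
    have hmod : ∀ p : K[X][X], p - (p.map (evalRingHom a)).map C ∈
        Ideal.span {u, v} ⊔ Ideal.span {C X - C (C a)} := by
      intro p
      apply Submodule.mem_sup_right
      rw [Ideal.mem_span_singleton, ← C_sub, C_dvd_iff_dvd_coeff]
      intro n
      rw [coeff_sub, coeff_map, coeff_map, dvd_iff_isRoot]
      simp
    set J := Ideal.span {u, v} ⊔ Ideal.span {C X - C (C a)} with hJ
    have hdJ : d.map C ∈ J := by
      obtain ⟨α, β, h⟩ := Ideal.mem_span_pair.1 hde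
      rw [← h, Polynomial.map_add, Polynomial.map_mul, Polynomial.map_mul]
      have hu : u ∈ J := Submodule.mem_sup_left (Ideal.subset_span (by simp))
      have hv : v ∈ J := Submodule.mem_sup_left (Ideal.subset_span (by simp))
      have hu' := sub_mem hu (hmod u)
      have hv' := sub_mem hv (hmod v)
      rw [sub_sub_cancel] at hu' hv'
      exact add_mem (J.mul_mem_left _ hu') (J.mul_mem_left _ hv')
    refine ⟨((p.map (evalRingHom a)) % d).map C, ⟨(p.map (evalRingHom a)) % d, ?_, hι _⟩, ?_⟩
    · rw [SetLike.mem_coe, mem_degreeLT, ← degree_eq_natDegree hd]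
      exact degree_mod_lt _ hd
    · have e : p - ((p.map (evalRingHom a)) % d).map C =
        (p - (p.map (evalRingHom a)).map C) +
          ((p.map (evalRingHom a)) / d).map C * d.map C := by
        have h' := congrArg (Polynomial.map C) (EuclideanDomain.div_add_mod (p.map (evalRingHom a)) d)
        rw [Polynomial.map_add, Polynomial.map_mul] at h'
        linear_combination -h'
      rw [e]
      exact add_mem (hmod p) (J.mul_mem_left _ hdJ)

end GK

namespace GK
open Polynomial Module
variable {K : Type*} [Field K]

lemma natDegree_le_Θ {u : K[X][X]} (hu : u.Monic) : u.natDegree ≤ (Θ K u).natDegree := by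
  apply le_natDegree_of_ne_zero
  intro h
  have h2 := congrArg (fun s => coeff s u.natDegree) h
  simp only [Θ_coeff] at h2
  rw [if_pos le_rfl, coeff_natDegree, hu.leadingCoeff] at h2
  simp at h2

lemma Θ_ne_zero {u : K[X][X]} (hu : u.Monic) : Θ K u ≠ 0 := by
  intro h
  have h2 := congrArg (fun s => coeff (coeff s u.natDegree) u.natDegree) h
  simp only [Θ_coeff] at h2
  rw [if_pos le_rfl, coeff_natDegree, hu.leadingCoeff] at h2
  simp at h2

variable [CharP K 2]

lemma F_natDegree {k : ℕ} (hk : 2 ≤ k) : (F K k).natDegree = k := by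
  have h1 : F K k = C (X + 1) * X ^ k + (C (X ^ k + 1) * X + C (X + X ^ k)) := by
    rw [F]
    have h2 : (2 : K[X][X]) = 0 := CharTwo.two_eq_zero
    simp only [C_add, C_pow, C_1]
    linear_combination h2
  rw [h1]
  have hne : (X + 1 : K[X]) ≠ 0 := (monic_X_add_C (1 : K)).ne_zero
  rw [natDegree_add_eq_left_of_degree_lt]
  · exact natDegree_C_mul_X_pow _ _ hne
  · rw [degree_C_mul_X_pow _ hne]
    refine (degree_linear_le).trans_lt ?_
    exact_mod_cast (by omega : 1 < k)

lemma F_leadingCoeff {k : ℕ} (hk : 2 ≤ k) : (F K k).leadingCoeff = X + 1 := by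
  rw [leadingCoeff, F_natDegree hk, F]
  have e : (C X ^ k + 1 : K[X][X]) = C (X ^ k + 1) := by simp
  have e2 : (C X + 1 : K[X][X]) = C (X + 1) := by simp
  rw [e, e2, coeff_add, coeff_C_mul, coeff_mul_C, coeff_add, coeff_add, coeff_X_pow_self, coeff_X,
    coeff_one, if_neg (by omega), if_neg (by omega)]
  ring

lemma infinity {k : ℕ} (hk : Even k) (hk2 : 2 ≤ k) {u v : K[X][X]} (hu : u.Monic) (hv : v.Monic)
    (huv : (C X + X) * (C X + 1) * (X + 1) * (u * v) = F K k) :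
    u.natDegree + v.natDegree + 2 = k ∧ (Θ K u).natDegree = u.natDegree ∧
    (Θ K v).natDegree = v.natDegree ∧ (Θ K u).leadingCoeff.natDegree = u.natDegree ∧
    IsCoprime (Θ K u).leadingCoeff (Θ K v).leadingCoeff := by
  have h2 : (2 : K[X][X]) = 0 := CharTwo.two_eq_zero
  have hx1 : (X + 1 : K[X]) ≠ 0 := (monic_X_add_C (1 : K)).ne_zero
  have hx1' : (1 + X : K[X]) ≠ 0 := by rwa [add_comm]
  have hLne : (C X + X : K[X][X]) ≠ 0 := by rw [add_comm]; exact (monic_X_add_C _).ne_zero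
  have hLne2 : (C X + 1 : K[X][X]) = C (X + 1) := by simp
  have hLne3 : (X + 1 : K[X][X]) ≠ 0 := (monic_X_add_C 1).ne_zero
  have e1 : u.natDegree + v.natDegree + 2 = k := by
    have := congrArg natDegree huv
    rw [F_natDegree hk2, natDegree_mul, natDegree_mul, natDegree_mul, natDegree_mul hu.ne_zero hv.ne_zero, hLne2, natDegree_C,
      add_comm (C X) X, natDegree_X_add_C, ← C_1, natDegree_X_add_C] at this
    · omega
    · exact hLne
    · rw [hLne2]; exact C_ne_zero.2 hx1
    · refine mul_ne_zero hLne ?_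
      rw [hLne2]; exact C_ne_zero.2 hx1
    · exact hLne3
    · refine mul_ne_zero (mul_ne_zero hLne ?_) hLne3
      rw [hLne2]; exact C_ne_zero.2 hx1
    · exact mul_ne_zero hu.ne_zero hv.ne_zero
  have hΘ := congrArg (Θ K) huv
  have hF : Θ K (F K k) = C (X ^ k + X) * X ^ (k + 1) + (C (X ^ k + 1) * X ^ k + C (X + 1) * X) := by
    rw [F]
    simp only [map_add, map_mul, map_one, map_pow, pen_x, pen_y]
    linear_combination h2
  have hwk : (X ^ k + X : K[X]) ≠ 0 := by
    intro h
    have := congrArg (fun s => coeff s k) h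
    simp only [coeff_add, coeff_X_pow_self, coeff_X, coeff_zero, if_neg (by omega : ¬ 1 = k)] at this
    simp at this
  have hdlt : (C (X ^ k + 1) * X ^ k + C (X + 1) * X : K[X][X]).degree <
      (C (X ^ k + X) * X ^ (k + 1) : K[X][X]).degree := by
    rw [degree_C_mul_X_pow _ hwk]
    refine (degree_add_le _ _).trans_lt (max_lt ?_ ?_)
    · exact (degree_C_mul_X_pow_le _ _).trans_lt (by exact_mod_cast Nat.lt_succ_self k)
    · exact (degree_C_mul_X_le _).trans_lt (by exact_mod_cast (by omega : 1 < k + 1))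
  have hFn : (Θ K (F K k)).natDegree = k + 1 := by
    rw [hF, natDegree_add_eq_left_of_degree_lt hdlt, natDegree_C_mul_X_pow _ _ hwk]
  have hFl : (Θ K (F K k)).leadingCoeff = X ^ k + X := by
    rw [hF, leadingCoeff_add_of_degree_lt' hdlt, leadingCoeff_mul, leadingCoeff_C,
      leadingCoeff_X_pow, mul_one]
  have hL : Θ K ((C X + X) * (C X + 1) * (X + 1)) = (C (1 + X) * X) * (X + C 1) * (C X * X + C 1) := by
    simp only [map_add, map_mul, map_one, pen_x, pen_y]
    ring
  have l1 : (C (1 + X) * X : K[X][X]).leadingCoeff = 1 + X := by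
    rw [leadingCoeff_mul, leadingCoeff_C, leadingCoeff_X, mul_one]
  have l3 : (C X * X + C 1 : K[X][X]).leadingCoeff = X := leadingCoeff_linear X_ne_zero
  have n1 : (C (1 + X) * X : K[X][X]).natDegree = 1 := natDegree_C_mul_X _ hx1'
  have n3 : (C X * X + C 1 : K[X][X]).natDegree = 1 := natDegree_linear X_ne_zero
  have ne1 : (C (1 + X) * X : K[X][X]) ≠ 0 := by rw [← leadingCoeff_ne_zero, l1]; exact hx1'
  have ne3 : (C X * X + C 1 : K[X][X]) ≠ 0 := by rw [← leadingCoeff_ne_zero, l3]; exact X_ne_zero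
  have ne2 : (X + C 1 : K[X][X]) ≠ 0 := (monic_X_add_C _).ne_zero
  rw [map_mul, hL, map_mul] at hΘ
  have hu0 := Θ_ne_zero hu
  have hv0 := Θ_ne_zero hv
  have hn := congrArg natDegree hΘ
  rw [hFn, natDegree_mul (mul_ne_zero (mul_ne_zero ne1 ne2) ne3)
    (mul_ne_zero hu0 hv0), natDegree_mul (mul_ne_zero ne1 ne2) ne3, natDegree_mul ne1 ne2,
    natDegree_mul hu0 hv0, n1, n3, natDegree_X_add_C] at hn
  have hl := congrArg leadingCoeff hΘ
  rw [hFl, leadingCoeff_mul, leadingCoeff_mul, leadingCoeff_mul _ (X + C 1),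
    leadingCoeff_mul (Θ K u), l1, l3,
    leadingCoeff_X_add_C, mul_one] at hl
  have hu1 := natDegree_le_Θ hu
  have hv1 := natDegree_le_Θ hv
  have wu : (Θ K u).leadingCoeff.natDegree ≤ (Θ K u).natDegree := pen_mem X_mem wX_mem u _
  have wv : (Θ K v).leadingCoeff.natDegree ≤ (Θ K v).natDegree := pen_mem X_mem wX_mem v _
  have hul : (Θ K u).leadingCoeff ≠ 0 := leadingCoeff_ne_zero.2 hu0
  have hvl : (Θ K v).leadingCoeff ≠ 0 := leadingCoeff_ne_zero.2 hv0
  obtain ⟨j, rfl⟩ : ∃ j, k = j + 1 := ⟨k - 1, by omega⟩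
  have hG : (1 + X) * ((Θ K u).leadingCoeff * (Θ K v).leadingCoeff) = (X ^ j - C 1 : K[X]) := by
    apply mul_left_cancel₀ (X_ne_zero : (X : K[X]) ≠ 0)
    have h2' : (2 : K[X]) = 0 := CharTwo.two_eq_zero
    rw [C_1]
    linear_combination hl + X * h2'
  have hsum : (Θ K u).leadingCoeff.natDegree + (Θ K v).leadingCoeff.natDegree + 1 = j := by
    have := congrArg natDegree hG
    rw [natDegree_X_pow_sub_C, natDegree_mul hx1' (mul_ne_zero hul hvl), natDegree_mul hul hvl,
      add_comm 1 X, ← C_1, natDegree_X_add_C] at this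
    omega
  refine ⟨e1, by omega, by omega, by omega, ?_⟩
  have hj : (j : K) ≠ 0 := by
    rw [Ne, CharP.cast_eq_zero_iff K 2]
    obtain ⟨r, hr⟩ := hk
    omega
  have hsep : (X ^ j - C 1 : K[X]).Separable := separable_X_pow_sub_C 1 hj one_ne_zero
  exact (hsep.of_dvd ⟨1 + X, by rw [← hG]; ring⟩).isCoprime

/-- the roots of unity -/
noncomputable abbrev Z (K : Type*) [Field K] (m : ℕ) : Finset K := nthRootsFinset m (1 : K)

lemma pow_q (t m : ℕ) : (X ^ (2 ^ t * m) + 1 : K[X]) = (X ^ m - 1) ^ 2 ^ t := by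
  rw [CharTwo.sub_eq_add, add_pow_char_pow, one_pow, ← pow_mul, mul_comm]

lemma k_zero {R : Type*} [CommRing R] [CharP R 2] {t m : ℕ} (ht : t ≠ 0) :
    ((2 ^ t * m : ℕ) : R) = 0 := by
  rw [CharP.cast_eq_zero_iff R 2]
  exact (dvd_pow_self 2 ht).mul_right m

lemma ord_q {t m : ℕ} (hm : Odd m) {b : K} (hb : b ^ m = 1) :
    rootMultiplicity b (X ^ (2 ^ t * m) + 1 : K[X]) = 2 ^ t := by
  have hm0 : (m : K) ≠ 0 := by
    rw [Ne, CharP.cast_eq_zero_iff K 2]; exact hm.not_two_dvd_nat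
  have hmp : 0 < m := hm.pos
  have hne : (X ^ m - 1 : K[X]) ≠ 0 := by rw [← C_1]; exact X_pow_sub_C_ne_zero hmp 1
  have h1 : rootMultiplicity b (X ^ m - 1 : K[X]) = 1 := by
    apply le_antisymm
    · exact rootMultiplicity_le_one_of_separable (by rw [← C_1]; exact separable_X_pow_sub_C 1 hm0 one_ne_zero) b
    · rw [Nat.succ_le_iff, rootMultiplicity_pos hne]; simp [hb]
  rw [pow_q]
  classical
  rw [← count_roots, roots_pow, Multiset.count_nsmul, count_roots, h1, mul_one]

lemma fib_ne {t m : ℕ} {a : K} (ha : a ^ m = 1) (ha1 : a ≠ 1) {u v : K[X][X]}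
    (huv : (C X + X) * (C X + 1) * (X + 1) * (u * v) = F K (2 ^ t * m)) :
    (X - C a) * (X - C 1) * (u.map (evalRingHom a) * v.map (evalRingHom a)) =
      X ^ (2 ^ t * m) + 1 := by
  have h := congrArg (Polynomial.map (evalRingHom a)) huv
  have hak : a ^ (2 ^ t * m) = 1 := by rw [mul_comm, pow_mul, ha, one_pow]
  simp only [F, Polynomial.map_mul, Polynomial.map_add, Polynomial.map_pow, Polynomial.map_X,
    Polynomial.map_C, Polynomial.map_one, coe_evalRingHom, eval_X] at h
  rw [← C_pow, hak, C_1, CharTwo.add_self_eq_zero, mul_zero, add_zero] at h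
  have hne : (C a + 1 : K[X]) ≠ 0 := by
    rw [← C_1, ← C_add]
    exact C_ne_zero.2 fun h => ha1 (CharTwo.add_eq_zero.1 h)
  apply mul_left_cancel₀ hne
  rw [CharTwo.sub_eq_add, CharTwo.sub_eq_add, C_1]
  linear_combination h

lemma fib_one {t m : ℕ} (ht : t ≠ 0) {u v : K[X][X]}
    (huv : (C X + X) * (C X + 1) * (X + 1) * (u * v) = F K (2 ^ t * m)) :
    (X - C 1) * (X - C 1) * (u.map (evalRingHom 1) * v.map (evalRingHom 1)) =
      X ^ (2 ^ t * m) + 1 := by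
  set k := 2 ^ t * m with hk
  have hgeo : (X + 1) * (∑ i ∈ Finset.range k, X ^ i) = (X ^ k + 1 : K[X]) := by
    have := mul_geom_sum (X : K[X]) k
    rwa [CharTwo.sub_eq_add, CharTwo.sub_eq_add] at this
  have h : (C X + X) * (X + 1) * (u * v) =
      (X ^ k + 1) + (X + 1) * C (∑ i ∈ Finset.range k, (X : K[X]) ^ i) := by
    have hne : (C X + 1 : K[X][X]) ≠ 0 := by
      rw [← C_1, ← C_add]
      exact C_ne_zero.2 (monic_X_add_C (1 : K)).ne_zero
    apply mul_left_cancel₀ hne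
    have hg := congrArg (C : K[X] →+* K[X][X]) hgeo
    simp only [C_mul, C_add, C_pow, C_1] at hg
    rw [F] at huv
    linear_combination huv - (X + 1) * hg
  have h3 := congrArg (Polynomial.map (evalRingHom (1 : K))) h
  have hz : eval 1 (∑ i ∈ Finset.range k, (X : K[X]) ^ i) = 0 := by
    rw [eval_finsetSum]; simp only [eval_pow, eval_X, one_pow, Finset.sum_const, Finset.card_range, nsmul_eq_mul, mul_one]
    exact k_zero ht
  simp only [Polynomial.map_mul, Polynomial.map_add, Polynomial.map_pow, Polynomial.map_X,
    Polynomial.map_C, Polynomial.map_one, coe_evalRingHom, eval_X] at h3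
  rw [hz, C_0, mul_zero, add_zero] at h3
  rw [← h3, CharTwo.sub_eq_add, C_1]
  ring

end GK

namespace GK
open Polynomial Module
variable {K : Type*} [Field K]

lemma mem_Z {m : ℕ} (hm : Odd m) {b : K} : b ∈ Z K m ↔ b ^ m = 1 := mem_nthRootsFinset hm.pos 1

variable [IsAlgClosed K]

lemma natDegree_common {p r d : K[X]} (hp : p ≠ 0) (hr : r ≠ 0) (hdp : d ∣ p) (hdr : d ∣ r)
    (s : Finset K) (hs : ∀ b, p.eval b = 0 → b ∈ s) :
    d.natDegree ≤ ∑ b ∈ s, min (rootMultiplicity b p) (rootMultiplicity b r) := by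
  classical
  rw [← IsAlgClosed.card_roots_eq_natDegree, ← Multiset.sum_count_eq_card (s := s)]
  · apply Finset.sum_le_sum
    intro b _
    rw [count_roots]
    exact le_min (rootMultiplicity_le_rootMultiplicity_of_dvd hp hdp b)
      (rootMultiplicity_le_rootMultiplicity_of_dvd hr hdr b)
  · intro b hb
    apply hs
    obtain ⟨c, rfl⟩ := hdp
    rw [eval_mul, (isRoot_of_mem_roots hb : eval b d = 0), zero_mul]

variable [CharP K 2]

lemma exists_prim {m : ℕ} (hm : Odd m) : ∃ ζ : K, IsPrimitiveRoot ζ m := by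
  have : NeZero (m : K) := ⟨by
    rw [Ne, CharP.cast_eq_zero_iff K 2]; exact hm.not_two_dvd_nat⟩
  exact HasEnoughRootsOfUnity.exists_primitiveRoot K m

lemma root_mem {t m : ℕ} (hm : Odd m) {b : K} {L u v : K[X]} (h : L * (u * v) = X ^ (2 ^ t * m) + 1)
    (hb : u.eval b = 0) : b ∈ Z K m := by
  have h1 := congrArg (eval b) h
  rw [pow_q] at h1
  simp only [eval_mul, hb, zero_mul, mul_zero, eval_pow, eval_sub, eval_X, eval_one] at h1
  rw [mem_Z hm]
  exact sub_eq_zero.1 (pow_eq_zero_iff (by positivity) |>.1 h1.symm)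

lemma arith_pt {s r e q' t : ℕ} {P Q : Prop} (he : e ≤ 1)
    (p1 : min s (r + e) ≤ 1 ∧ (t = 1 → 1 ≤ min s (r + e) → P ∨ Q))
    (p2 : min (s + e) r ≤ 1) (hq : e + (s + r) = 2 * q') :
    (e = 1 → min s r = 0) ∧ (e = 0 → min s r ≤ 1 ∧ (t = 1 → 1 ≤ min s r → P ∨ Q)) := by
  constructor
  · rintro rfl
    have := p1.1
    omega
  · rintro rfl
    exact p1

open Classical in
/-- the order of the line factors at `b` -/
noncomputable def eps (a b : K) : ℕ := (if b = a then 1 else 0) + (if b = 1 then 1 else 0)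

lemma fib_pt {t m : ℕ} (ht : t ≠ 0) (hm : Odd m) {a b : K} (ha : a ^ m = 1) (ha1 : a ≠ 1)
    (hb : b ^ m = 1)
    {u v : K[X][X]} (hu : u.Monic) (hv : v.Monic)
    (huv : (C X + X) * (C X + 1) * (X + 1) * (u * v) = F K (2 ^ t * m)) :
    (eps a b = 1 → min (rootMultiplicity b (u.map (evalRingHom a)))
      (rootMultiplicity b (v.map (evalRingHom a))) = 0) ∧
    (eps a b = 0 → min (rootMultiplicity b (u.map (evalRingHom a)))
      (rootMultiplicity b (v.map (evalRingHom a))) ≤ 1 ∧ (t = 1 →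
      1 ≤ min (rootMultiplicity b (u.map (evalRingHom a)))
      (rootMultiplicity b (v.map (evalRingHom a))) → b = 1 ∨ a = b ∨ a * b + a + b = 0)) := by
  classical
  have hu0 : u.map (evalRingHom a) ≠ 0 := (hu.map _).ne_zero
  have hv0 : v.map (evalRingHom a) ≠ 0 := (hv.map _).ne_zero
  have hfib := fib_ne ha ha1 huv
  obtain ⟨L, hL⟩ : ∃ L : K[X][X], L = (C X + X) * (C X + 1) * (X + 1) := ⟨_, rfl⟩
  have ha1' : a + 1 ≠ 0 := fun h => ha1 (CharTwo.add_eq_zero.1 h)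
  have hLa : L.map (evalRingHom a) = C (a + 1) * ((X - C a) * (X - C 1)) := by
    simp only [hL, Polynomial.map_mul, Polynomial.map_add, Polynomial.map_X,
    Polynomial.map_C, Polynomial.map_one, coe_evalRingHom, eval_X]
    rw [CharTwo.sub_eq_add, CharTwo.sub_eq_add, C_add, C_1]
    ring
  have hLL0 : ((X - C a) * (X - C 1) : K[X]) ≠ 0 :=
    mul_ne_zero (X_sub_C_ne_zero a) (X_sub_C_ne_zero 1)
  have hL0 : L.map (evalRingHom a) ≠ 0 := by
    rw [hLa]; exact mul_ne_zero (C_ne_zero.2 ha1') hLL0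
  have hLord : rootMultiplicity b (L.map (evalRingHom a)) = eps a b := by
    rw [hLa, rootMultiplicity_mul (by rw [← hLa]; exact hL0), rootMultiplicity_C, zero_add,
      rootMultiplicity_mul hLL0, rootMultiplicity_X_sub_C, rootMultiplicity_X_sub_C, eps]
  have hvL : rootMultiplicity b ((v * L).map (evalRingHom a)) =
      rootMultiplicity b (v.map (evalRingHom a)) + eps a b := by
    rw [Polynomial.map_mul, rootMultiplicity_mul (mul_ne_zero hv0 hL0), hLord]
  have huL : rootMultiplicity b ((u * L).map (evalRingHom a)) =
      rootMultiplicity b (u.map (evalRingHom a)) + eps a b := by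
    rw [Polynomial.map_mul, rootMultiplicity_mul (mul_ne_zero hu0 hL0), hLord]
  have hvL0 : (v * L).map (evalRingHom a) ≠ 0 := by
    rw [Polynomial.map_mul]; exact mul_ne_zero hv0 hL0
  have huL0 : (u * L).map (evalRingHom a) ≠ 0 := by
    rw [Polynomial.map_mul]; exact mul_ne_zero hu0 hL0
  obtain ⟨q', hq'⟩ : ∃ q', 2 ^ t = 2 * q' := dvd_pow_self 2 ht
  have hq : eps a b + (rootMultiplicity b (u.map (evalRingHom a)) +
      rootMultiplicity b (v.map (evalRingHom a))) = 2 * q' := by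
    rw [← hq', ← ord_q (t := t) hm hb, ← hfib,
      rootMultiplicity_mul (mul_ne_zero hLL0 (mul_ne_zero hu0 hv0)),
      rootMultiplicity_mul hLL0, rootMultiplicity_X_sub_C, rootMultiplicity_X_sub_C,
      rootMultiplicity_mul (mul_ne_zero hu0 hv0), eps]
  have p1 := ptA (b := b) ht hm ha hb ha1 (u := u) (v := v * L) (by rw [← huv, hL]; ring) hu0 hvL0
  have p2 := ptA (b := b) ht hm ha hb ha1 (u := u * L) (v := v) (by rw [← huv, hL]; ring) huL0 hv0
  rw [hvL] at p1
  rw [huL] at p2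
  refine arith_pt ?_ p1 p2.1 hq
  rw [eps]
  split_ifs with h1 h2
  · exact absurd (h1.symm.trans h2) ha1
  all_goals omega

lemma fib_bound_ne {t m : ℕ} (ht : t ≠ 0) (hm : Odd m) {a : K} (ha : a ^ m = 1) (ha1 : a ≠ 1)
    {u v : K[X][X]} (hu : u.Monic) (hv : v.Monic)
    (huv : (C X + X) * (C X + 1) * (X + 1) * (u * v) = F K (2 ^ t * m)) :
    ∑ b ∈ Z K m, min (rootMultiplicity b (u.map (evalRingHom a)))
      (rootMultiplicity b (v.map (evalRingHom a))) ≤ if t = 1 then 1 else m - 2 := by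
  classical
  have ha1' : a + 1 ≠ 0 := fun h => ha1 (CharTwo.add_eq_zero.1 h)
  have main : ∀ b ∈ Z K m, min (rootMultiplicity b (u.map (evalRingHom a)))
      (rootMultiplicity b (v.map (evalRingHom a))) ≤
      if b ∈ ({a, 1} : Finset K) then 0 else
        if t = 1 then (if b = a / (a + 1) then 1 else 0) else 1 := by
    intro b hb
    rw [mem_Z hm] at hb
    have q := fib_pt ht hm ha ha1 hb hu hv huv
    generalize min (rootMultiplicity b (u.map (evalRingHom a)))
      (rootMultiplicity b (v.map (evalRingHom a))) = M at q ⊢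
    by_cases hba : b = a
    · have hb1 : b ≠ 1 := by rw [hba]; exact ha1
      rw [if_pos (by simp [hba])]
      exact (q.1 (by simp [eps, if_pos hba, if_neg hb1])).le
    by_cases hb1 : b = 1
    · rw [if_pos (by simp [hb1])]
      exact (q.1 (by rw [eps, if_pos hb1, if_neg hba])).le
    rw [if_neg (by simp [hba, hb1])]
    have q2 := q.2 (by rw [eps, if_neg hb1, if_neg hba])
    split_ifs with h1 h2
    · exact q2.1
    · by_contra hcon
      rcases q2.2 h1 (by omega) with h | h | h
      · exact hb1 h
      · exact hba h.symm
      · apply h2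
        rw [eq_div_iff ha1']
        have h2 : (2 : K) = 0 := CharTwo.two_eq_zero
        linear_combination h - a * h2
    · exact q2.1
  refine (Finset.sum_le_sum main).trans ?_
  split_ifs with h1
  · have hle : ∀ b ∈ Z K m, (if b ∈ ({a, 1} : Finset K) then 0 else
        (if b = a / (a + 1) then 1 else 0)) ≤ if b = a / (a + 1) then 1 else 0 := by
      intro b _
      split_ifs <;> omega
    refine (Finset.sum_le_sum hle).trans ?_
    rw [Finset.sum_ite_eq']
    split_ifs <;> omega
  · obtain ⟨ζ, hζ⟩ := exists_prim (K := K) hm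
    have hc := hζ.card_nthRootsFinset
    have hsub : ({a, 1} : Finset K) ⊆ Z K m := by
      intro x hx
      rw [mem_Z hm]
      simp only [Finset.mem_insert, Finset.mem_singleton] at hx
      rcases hx with rfl | rfl
      · exact ha
      · simp
    have : ∑ b ∈ Z K m, (if b ∈ ({a, 1} : Finset K) then 0 else 1) = (Z K m \ {a, 1}).card := by
      rw [Finset.card_eq_sum_ones, Finset.sum_ite]
      rw [Finset.sum_const_zero, zero_add, Finset.sdiff_eq_filter]
    rw [this, Finset.card_sdiff_of_subset hsub, hc, Finset.card_pair ha1]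

lemma fib_bound_one {t m : ℕ} (ht : t ≠ 0) (hm : Odd m)
    {u v : K[X][X]} (hu : u.Monic) (hv : v.Monic)
    (huv : (C X + X) * (C X + 1) * (X + 1) * (u * v) = F K (2 ^ t * m)) :
    ∑ b ∈ Z K m, min (rootMultiplicity b (u.map (evalRingHom 1)))
      (rootMultiplicity b (v.map (evalRingHom 1))) ≤
      min (rootMultiplicity 1 (u.map (evalRingHom 1))) (rootMultiplicity 1 (v.map (evalRingHom 1))) := by
  classical
  have hu0 : u.map (evalRingHom 1) ≠ 0 := (hu.map _).ne_zero
  have hv0 : v.map (evalRingHom 1) ≠ 0 := (hv.map _).ne_zero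
  rw [Finset.sum_eq_single 1]
  · intro b hb hb1
    rw [mem_Z hm] at hb
    rcases ptB ht hm hb hb1 huv with h | h
    · rw [rootMultiplicity_eq_zero h]; simp
    · rw [rootMultiplicity_eq_zero h]; simp
  · intro h; exact absurd ((mem_Z hm).2 (one_pow m)) h

lemma ord_one {t m : ℕ} (ht : t ≠ 0) (hm : Odd m)
    {u v : K[X][X]} (hu : u.Monic) (hv : v.Monic)
    (huv : (C X + X) * (C X + 1) * (X + 1) * (u * v) = F K (2 ^ t * m)) :
    rootMultiplicity 1 (u.map (evalRingHom 1)) + rootMultiplicity 1 (v.map (evalRingHom 1)) + 2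
      = 2 ^ t := by
  classical
  have hu0 : u.map (evalRingHom 1) ≠ 0 := (hu.map _).ne_zero
  have hv0 : v.map (evalRingHom 1) ≠ 0 := (hv.map _).ne_zero
  have hx : (X - C 1 : K[X]) ≠ 0 := X_sub_C_ne_zero 1
  rw [← ord_q (K := K) (t := t) (b := 1) hm (one_pow m), ← fib_one ht huv,
    rootMultiplicity_mul (mul_ne_zero (mul_ne_zero hx hx) (mul_ne_zero hu0 hv0)),
    rootMultiplicity_mul (mul_ne_zero hx hx), rootMultiplicity_X_sub_C, if_pos rfl,
    rootMultiplicity_mul (mul_ne_zero hu0 hv0)]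
  ring

theorem geometric {t m : ℕ} (ht : t ≠ 0) (hm : Odd m) 
    {u v : K[X][X]} (hu : u.Monic) (hv : v.Monic)
    (huv : (C X + X) * (C X + 1) * (X + 1) * (u * v) = F K (2 ^ t * m)) :
    u.natDegree * v.natDegree ≤ 2 ^ t * ((m - 1) * (if t = 1 then 1 else m - 2) +
      min (rootMultiplicity 1 (u.map (evalRingHom 1))) (rootMultiplicity 1 (v.map (evalRingHom 1)))) := by
  classical
  obtain ⟨q', hq'⟩ : ∃ q', 2 ^ t = 2 * q' := dvd_pow_self 2 ht
  have hq0 : 0 < 2 ^ t := by positivity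
  have hmp := hm.pos
  have hk : Even (2 ^ t * m) := by rw [hq', mul_assoc]; exact even_two_mul _
  have hk2 : 2 ≤ 2 ^ t * m := by
    calc 2 ≤ 2 ^ t * 1 := by omega
      _ ≤ _ := Nat.mul_le_mul_left _ hmp
  obtain ⟨-, h2, h3, h4, h5⟩ := infinity hk hk2 hu hv huv
  refine bezout hu rfl h2 h3 h4 (Θ_ne_zero hv) h5 ?_
  set I := Ideal.span {u, v} with hI
  obtain ⟨ζ, hζ⟩ := exists_prim (K := K) hm
  have huI : u ∈ I := Ideal.subset_span (by simp)
  have hvI : v ∈ I := Ideal.subset_span (by simp)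
  have hmem : (C X ^ (2 ^ t * m) + 1 : K[X][X]) ∈ I := by
    have hd := congrArg derivative huv
    have hF : derivative (F K (2 ^ t * m)) = C X ^ (2 ^ t * m) + 1 := by
      have e : (C X ^ (2 ^ t * m) + 1 : K[X][X]) = C (X ^ (2 ^ t * m) + 1) := by simp
      have e2 : (C X + 1 : K[X][X]) = C (X + 1) := by simp
      rw [F, e, e2, derivative_add, derivative_mul, derivative_mul, derivative_C, derivative_C,
        derivative_add, derivative_X_pow, k_zero (R := K[X]) ht, derivative_add, derivative_X,
        derivative_one, C_0]
      ring
    rw [← hF, ← hd, derivative_mul, derivative_mul (f := u)]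
    refine add_mem (I.mul_mem_left _ (I.mul_mem_left _ hvI)) (I.mul_mem_left _ (add_mem ?_ ?_))
    · exact I.mul_mem_left _ hvI
    · exact I.mul_mem_right _ huI
  have hprod : (C X ^ (2 ^ t * m) + 1 : K[X][X]) = (∏ a ∈ Z K m, (C X - C (C a))) ^ 2 ^ t := by
    have := pow_q (K := K) t m
    rw [X_pow_sub_one_eq_prod hmp hζ] at this
    have := congrArg (C : K[X] →+* K[X][X]) this
    simpa [map_prod] using this
  have hIs : I ⊔ Ideal.span {(∏ a ∈ Z K m, (C X - C (C a))) ^ 2 ^ t} = I := by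
    rw [sup_eq_left, Ideal.span_singleton_le_iff_mem, ← hprod]; exact hmem
  have key : ∀ a ∈ Z K m, Cod (I ⊔ Ideal.span {C X - C (C a)})
      (EuclideanDomain.gcd (u.map (evalRingHom a)) (v.map (evalRingHom a))).natDegree := by
    intro a _
    apply Cod_base
    · intro h
      rw [EuclideanDomain.gcd_eq_zero_iff] at h
      exact (hu.map _).ne_zero h.1
    · rw [← EuclideanDomain.span_gcd]; exact Ideal.subset_span (by simp)
  have hC := Cod_pow I _ _ (2 ^ t) (Cod_prod I (Z K m) _ _ key)
  rw [hIs] at hC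
  obtain ⟨W, w1, w2, w3⟩ := hC
  refine ⟨W, w1, w2.trans (Nat.mul_le_mul_left _ ?_), w3⟩
  have h1Z : (1 : K) ∈ Z K m := (mem_Z hm).2 (one_pow m)
  rw [← Finset.sum_erase_add _ _ h1Z]
  have hcard : (Finset.erase (Z K m) 1).card = m - 1 := by
    rw [Finset.card_erase_of_mem h1Z, hζ.card_nthRootsFinset]
  refine add_le_add ?_ ?_
  · rw [← hcard, ← smul_eq_mul]
    apply Finset.sum_le_card_nsmul
    intro a ha
    obtain ⟨ha1, ha⟩ := Finset.mem_erase.1 ha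
    rw [mem_Z hm] at ha
    refine (natDegree_common (hu.map _).ne_zero (hv.map _).ne_zero
      (EuclideanDomain.gcd_dvd_left _ _) (EuclideanDomain.gcd_dvd_right _ _) (Z K m)
      (fun b hb => root_mem hm (fib_ne ha ha1 huv) hb)).trans (fib_bound_ne ht hm ha ha1 hu hv huv)
  · refine (natDegree_common (hu.map _).ne_zero (hv.map _).ne_zero
      (EuclideanDomain.gcd_dvd_left _ _) (EuclideanDomain.gcd_dvd_right _ _) (Z K m)
      (fun b hb => root_mem hm (fib_one ht huv) hb)).trans (fib_bound_one ht hm hu hv huv)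

end GK

namespace GK

lemma numeric {t m r d s j : ℕ} (ht : t ≠ 0) (hm : Odd m) (hm3 : 3 ≤ m) (hk6 : 2 ^ t * m ≠ 6)
    (hr : 2 ≤ r) (hj : j = r / 2) (hd : r * d + 2 = 2 ^ t * m) (hs : r * s + 2 = 2 ^ t)
    (hb : (j * d) * ((r - j) * d) ≤ 2 ^ t * ((m - 1) * (if t = 1 then 1 else m - 2) +
      min (j * s) ((r - j) * s))) : False := by
  obtain ⟨i, hi⟩ : ∃ i, r = j + i := ⟨r - j, by omega⟩
  have hi2 : i = j ∨ i = j + 1 := by omega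
  have hj1 : 1 ≤ j := by omega
  have hri : r - j = i := by omega
  rw [hri] at hb
  obtain ⟨n, rfl⟩ : ∃ n, m = n + 3 := ⟨m - 3, by omega⟩
  have e1 : n + 3 - 1 = n + 2 := by omega
  have e2 : n + 3 - 2 = n + 1 := by omega
  rw [e1, e2] at hb
  clear hri e1 e2
  have hd0 : 1 ≤ d := by
    rcases Nat.eq_zero_or_pos d with rfl | h
    · have : 2 ^ 1 ≤ 2 ^ t := Nat.pow_le_pow_right (by norm_num) (by omega)
      rw [mul_zero] at hd
      nlinarith
    · exact h
  by_cases h1 : t = 1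
  · subst h1
    have hs0 : s = 0 := by
      rcases Nat.eq_zero_or_pos s with h | h
      · exact h
      · have := Nat.mul_pos (by omega : 0 < r) h
        omega
    subst hs0
    rw [if_pos rfl] at hb
    simp only [mul_zero, min_self, add_zero, mul_one, pow_one] at hb hd hk6
    have h2 : 2 * (n + 2) = r * d := by omega
    have h3 : j * i * d ≤ r := by
      rw [h2] at hb
      have : (j * i * d) * d ≤ r * d := by nlinarith
      exact Nat.le_of_mul_le_mul_right this hd0
    subst hi
    obtain ⟨c, hc⟩ := hm
    have hd4 : j * i ≤ j + i := by nlinarith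
    have hj2 : j ≤ 2 := by rcases hi2 with rfl | rfl <;> nlinarith
    interval_cases j
    · rcases hi2 with rfl | rfl
      · have : d ≤ 2 := by omega
        interval_cases d <;> omega
      · have : d ≤ 1 := by omega
        interval_cases d; omega
    · rcases hi2 with rfl | rfl
      · have : d ≤ 1 := by omega
        interval_cases d; omega
      · omega
  · rw [if_neg h1] at hb
    have hmin := min_le_left (j * s) (i * s)
    generalize min (j * s) (i * s) = M at hb hmin
    have hM : 2 * M + 2 ≤ 2 ^ t := by
      rw [← hs, hi]
      have : j * s ≤ i * s := Nat.mul_le_mul_right _ (by omega)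
      nlinarith
    by_cases h2 : t = 2
    · subst h2
      norm_num at *
      have hr2 : r = 2 := by
        have : r ∣ 2 := ⟨s, by omega⟩
        exact le_antisymm (Nat.le_of_dvd (by norm_num) this) hr
      subst hr2
      have : j = 1 := by omega
      subst this
      have : i = 1 := by omega
      subst this
      have : d = 2 * n + 5 := by omega
      subst this
      nlinarith
    · have hq : 2 ^ 3 ≤ 2 ^ t := Nat.pow_le_pow_right (by norm_num) (by omega)
      generalize 2 ^ t = q at *
      have h9 : 2 * r ^ 2 ≤ 9 * (j * i) := by
        rw [hi]
        rcases hi2 with rfl | rfl <;> nlinarith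
      have h10 : 2 * (r * d) ^ 2 ≤ 9 * ((j * d) * (i * d)) := by
        have := Nat.mul_le_mul_right (d ^ 2) h9
        nlinarith
      obtain ⟨p, rfl⟩ : ∃ p, q = p + 8 := ⟨q - 8, by omega⟩
      have h11 : r * d = (p + 8) * (n + 3) - 2 := by omega
      have h12 : r * d = p * n + 3 * p + 8 * n + 22 := by
        have : (p + 8) * (n + 3) = p * n + 3 * p + 8 * n + 24 := by ring
        omega
      have hM2 : 2 * M ≤ p + 6 := by omega
      have h13 := h10.trans (Nat.mul_le_mul_left 9 hb)
      rw [h12] at h13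
      have h14 : 4 * (p * n + 3 * p + 8 * n + 22) ^ 2 ≤ 9 * ((p + 8) * (2 * ((n + 2) * (n + 1)) + (p + 6))) := by
        have := Nat.mul_le_mul_left (p + 8) hM2
        nlinarith
      ring_nf at h14
      have := Nat.zero_le (p ^ 2 * n ^ 2)
      have := Nat.zero_le (p ^ 2 * n)
      have := Nat.zero_le (p * n ^ 2)
      have := Nat.zero_le (p * n)
      have := Nat.zero_le (p ^ 2)
      have := Nat.zero_le (n ^ 2)
      omega

end GK

namespace GK
open Polynomial

section
variable {K : Type*} [Field K] [CharP K 2] [IsAlgClosed K]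

/-- Frobenius on coefficients -/
noncomputable def σ (K : Type*) [Field K] [CharP K 2] [IsAlgClosed K] : K[X][X] ≃+* K[X][X] :=
  mapEquiv (mapEquiv (frobeniusEquiv K 2))

lemma σ_apply (p : K[X][X]) : σ K p = p.map (mapRingHom (frobenius K 2)) := by
  rfl

attribute [irreducible] σ

lemma σ_monic {p : K[X][X]} (hp : p.Monic) : (σ K p).Monic := by
  rw [σ_apply]; exact hp.map _

lemma σ_natDegree {p : K[X][X]} (hp : p.Monic) : (σ K p).natDegree = p.natDegree := by
  rw [σ_apply]; exact hp.natDegree_map _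

lemma σ_ord (p : K[X][X]) : rootMultiplicity 1 ((σ K p).map (evalRingHom 1)) =
    rootMultiplicity 1 (p.map (evalRingHom 1)) := by
  have h : (σ K p).map (evalRingHom 1) = (p.map (evalRingHom 1)).map (frobenius K 2) := by
    rw [σ_apply, Polynomial.map_map, Polynomial.map_map]
    congr 1
    ext x
    · simp
    · simp
  have h3 := eq_rootMultiplicity_map (p := p.map (evalRingHom 1)) (frobenius_inj K 2) (1:K)
  rw [map_one] at h3
  rw [h]
  exact h3.symm

lemma iter_props {h : K[X][X]} (hh : h.Monic) (hirr : Irreducible h) (i : ℕ) :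
    ((σ K)^[i] h).Monic ∧ Irreducible ((σ K)^[i] h) ∧ ((σ K)^[i] h).natDegree = h.natDegree ∧
    rootMultiplicity 1 (((σ K)^[i] h).map (evalRingHom 1)) =
      rootMultiplicity 1 (h.map (evalRingHom 1)) := by
  induction i with
  | zero => exact ⟨hh, hirr, rfl, rfl⟩
  | succ i ih =>
    obtain ⟨a, b, c, d⟩ := ih
    rw [Function.iterate_succ_apply']
    exact ⟨σ_monic a, (MulEquiv.irreducible_iff (σ K)).2 b, (σ_natDegree a).trans c, (σ_ord _).trans d⟩

lemma ord_prod {ι : Type*} (S : Finset ι) (f : ι → K[X][X]) (hf : ∀ i ∈ S, (f i).Monic) (s : ℕ)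
    (hs : ∀ i ∈ S, rootMultiplicity 1 ((f i).map (evalRingHom 1)) = s) :
    rootMultiplicity 1 ((∏ i ∈ S, f i).map (evalRingHom 1)) = S.card * s := by
  classical
  induction S using Finset.induction_on with
  | empty => simp
  | insert i S hi ih =>
    rw [Finset.prod_insert hi, Polynomial.map_mul, rootMultiplicity_mul, hs i (by simp),
      ih (fun j hj => hf j (by simp [hj])) (fun j hj => hs j (by simp [hj])),
      Finset.card_insert_of_notMem hi]
    · ring
    · exact mul_ne_zero ((hf i (by simp)).map _).ne_zero
        ((monic_prod_of_monic _ _ fun j hj => hf j (by simp [hj])).map _).ne_zero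

lemma exists_monic_irr {g : K[X][X]} (hg : g.Monic) (hd : 0 < g.natDegree) :
    ∃ h : K[X][X], h.Monic ∧ Irreducible h ∧ h ∣ g := by
  obtain ⟨p, hp, c, hc⟩ := exists_irreducible_of_natDegree_pos hd
  have hl : p.leadingCoeff * c.leadingCoeff = 1 := by
    rw [← leadingCoeff_mul, ← hc]; exact hg
  have hu : IsUnit (C c.leadingCoeff : K[X][X]) := 
    isUnit_C.2 (IsUnit.of_mul_eq_one p.leadingCoeff (by rw [mul_comm]; exact hl))
  have hass : Associated (p * C c.leadingCoeff) p := associated_mul_unit_left _ _ hu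
  refine ⟨p * C c.leadingCoeff, ?_, hass.irreducible_iff.2 hp, ?_⟩
  · rw [Monic, leadingCoeff_mul, leadingCoeff_C, hl]
  · exact hass.dvd.trans ⟨c, hc⟩

lemma isPeriodic {g h : K[X][X]} (hg : g.Monic) (hσ : σ K g = g) (hh : h.Monic)
    (hirr : Irreducible h) (hd : h ∣ g) : (∀ i, (σ K)^[i] h ∣ g) ∧ h ∈ Function.periodicPts (σ K) := by
  have hdi : ∀ i, (σ K)^[i] h ∣ g := by
    intro i
    induction i with
    | zero => exact hd
    | succ i ih =>
      have h1 := map_dvd (σ K) ih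
      rw [hσ] at h1
      rw [Function.iterate_succ_apply']
      exact h1
  refine ⟨hdi, ?_⟩
  have hex := fun i => UniqueFactorizationMonoid.exists_mem_factors_of_dvd hg.ne_zero
    (iter_props hh hirr i).2.1 (hdi i)
  choose f hf hfa using hex
  classical
  obtain ⟨i, j, hij, he⟩ := Finite.exists_ne_map_eq_of_infinite
    (fun i : ℕ => (⟨f i, Multiset.mem_toFinset.2 (hf i)⟩ :
      (UniqueFactorizationMonoid.factors g).toFinset))
  have he : f i = f j := congrArg Subtype.val he
  have heq : (σ K)^[i] h = (σ K)^[j] h :=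
    eq_of_monic_of_associated (iter_props hh hirr i).1 (iter_props hh hirr j).1
      ((hfa i).trans (by rw [he]; exact (hfa j).symm))
  have aux : ∀ i j : ℕ, i < j → (σ K)^[i] h = (σ K)^[j] h → h ∈ Function.periodicPts (σ K) := by
    intro i j hij heq
    refine ⟨j - i, by omega, ?_⟩
    apply (σ K).injective.iterate i
    rw [← Function.iterate_add_apply, heq]
    congr 2
    omega
  rcases lt_or_gt_of_ne hij with h1 | h1
  · exact aux i j h1 heq
  · exact aux j i h1 heq.symm

end

section
variable {K : Type*} [Field K] [CharP K 2] [IsAlgClosed K] [Algebra (ZMod 2) K]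

/-- base change -/
noncomputable abbrev bc (K : Type*) [Field K] [Algebra (ZMod 2) K] : (ZMod 2)[X] →+* K[X] :=
  mapRingHom (algebraMap (ZMod 2) K)

lemma bc_inj : Function.Injective (bc K) := map_injective _ (algebraMap (ZMod 2) K).injective

lemma descend {P : K[X][X]} (hP : σ K P = P) : ∃ P0 : (ZMod 2)[X][X], P0.map (bc K) = P := by
  have : P ∈ lifts (bc K) := by
    rw [lifts_iff_coeff_lifts]
    intro n
    have h2 : (P.coeff n).map (frobenius K 2) = P.coeff n := by
      conv_rhs => rw [← hP, σ_apply, coeff_map]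
      rfl
    have h3 : P.coeff n ∈ lifts (algebraMap (ZMod 2) K) := by
      rw [lifts_iff_coeff_lifts]
      intro i
      have h4 := congrArg (fun s => coeff s i) h2
      simp only [coeff_map, frobenius_def] at h4
      have h5 : (P.coeff n).coeff i * ((P.coeff n).coeff i - 1) = 0 := by linear_combination h4
      rcases mul_eq_zero.1 h5 with h | h
      · exact ⟨0, by rw [h, map_zero]⟩
      · exact ⟨1, by rw [sub_eq_zero.1 h, map_one]⟩
    obtain ⟨p, hp⟩ := (mem_lifts _).1 h3
    exact ⟨p, hp⟩
  exact (mem_lifts _).1 this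

lemma σ_bc (P0 : (ZMod 2)[X][X]) : σ K (P0.map (bc K)) = P0.map (bc K) := by
  rw [σ_apply, Polynomial.map_map]
  have hf : ∀ x : ZMod 2, frobenius K 2 (algebraMap _ _ x) = algebraMap _ _ x := fun x => by
    rw [frobenius_def, ← map_pow, ZMod.pow_card x]
  congr 1
  ext x
  · simp [hf]
  · simp

lemma orbit {g0 : (ZMod 2)[X][X]} {h : K[X][X]} (hg0 : g0.Monic) (hirr0 : Irreducible g0)
    (hh : h.Monic) (hirr : Irreducible h) (hd : h ∣ g0.map (bc K)) :
    ∃ r, 0 < r ∧ g0.map (bc K) = ∏ i ∈ Finset.range r, (σ K)^[i] h := by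
  have hg := hg0.map (bc K)
  obtain ⟨hdi, hper⟩ := isPeriodic hg (σ_bc g0) hh hirr hd
  set r := Function.minimalPeriod (σ K) h with hr
  have hr0 : 0 < r := Function.minimalPeriod_pos_of_mem_periodicPts hper
  refine ⟨r, hr0, ?_⟩
  have hPd : ∏ i ∈ Finset.range r, (σ K)^[i] h ∣ g0.map (bc K) := by
    apply Finset.prod_dvd_of_isRelPrime
    · intro i hi j hj hij
      change IsRelPrime _ _
      rw [(iter_props hh hirr i).2.1.isRelPrime_iff_not_dvd]
      intro hdv
      have hass := (iter_props hh hirr i).2.1.associated_of_dvd (iter_props hh hirr j).2.1 hdv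
      have heq := eq_of_monic_of_associated (iter_props hh hirr i).1 (iter_props hh hirr j).1 hass
      apply hij
      refine Function.iterate_injOn_Iio_minimalPeriod (f := σ K) (x := h) ?_ ?_ heq
      · simpa using hi
      · simpa using hj
    · intro i _; exact hdi i
  have hPm : (∏ i ∈ Finset.range r, (σ K)^[i] h).Monic :=
    monic_prod_of_monic _ _ fun i _ => (iter_props hh hirr i).1
  have hσP : σ K (∏ i ∈ Finset.range r, (σ K)^[i] h) = ∏ i ∈ Finset.range r, (σ K)^[i] h := by
    rw [map_prod]
    obtain ⟨r', hr'⟩ : ∃ r', r = r' + 1 := ⟨r - 1, by omega⟩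
    have hrr : (σ K)^[r' + 1] h = h := by rw [← hr', hr]; exact Function.iterate_minimalPeriod
    rw [hr', Finset.prod_range_succ, Finset.prod_range_succ', ← Function.iterate_succ_apply' (σ K) r',
      hrr]
    simp only [Function.iterate_succ_apply', Function.iterate_zero, id_eq]
  obtain ⟨P0, hP0⟩ := descend hσP
  rw [← hP0] at hPd hPm ⊢
  have hP0m := monic_of_injective bc_inj hPm
  rw [map_dvd_map _ bc_inj hP0m] at hPd
  have hnu : ¬ IsUnit P0 := by
    intro hu
    have := hP0m.eq_one_of_isUnit hu
    rw [this, Polynomial.map_one] at hP0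
    have h1 : h ∣ 1 := by
      have h2 := Finset.dvd_prod_of_mem (fun i => (σ K)^[i] h) (Finset.mem_range.2 hr0)
      rw [← hP0] at h2
      simpa only [Function.iterate_zero, id_eq] using h2
    exact hirr.not_isUnit (isUnit_of_dvd_one h1)
  obtain ⟨c, hc⟩ := hPd
  have hcu := (hirr0.isUnit_or_isUnit hc).resolve_left hnu
  have : g0 = P0 := eq_of_monic_of_associated hg0 hP0m (by
    rw [hc]; exact associated_mul_unit_left _ _ hcu)
  rw [this]

theorem main_bi {t m : ℕ} (ht : t ≠ 0) (hm : Odd m) (hm3 : 3 ≤ m) (hk6 : 2 ^ t * m ≠ 6)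
    {g0 : (ZMod 2)[X][X]} (hirr0 : Irreducible g0)
    (hg : (C X + X) * (C X + 1) * (X + 1) * g0 = F (ZMod 2) (2 ^ t * m)) :
    Irreducible (g0.map (bc K)) := by
  obtain ⟨q', hq'⟩ : ∃ q', 2 ^ t = 2 * q' := dvd_pow_self 2 ht
  have hq0 : 0 < 2 ^ t := by positivity
  have hk : Even (2 ^ t * m) := by rw [hq', mul_assoc]; exact even_two_mul _
  have hk2 : 6 ≤ 2 ^ t * m := by
    calc 6 ≤ 2 ^ t * 3 := by omega
      _ ≤ _ := Nat.mul_le_mul_left _ hm3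
  have hgm : g0.Monic := by
    have hl := congrArg leadingCoeff hg
    have e1 : (C X + X : (ZMod 2)[X][X]) = X + C X := add_comm _ _
    have e2 : (C X + 1 : (ZMod 2)[X][X]) = C (X + 1) := by simp
    have e3 : (X + 1 : (ZMod 2)[X][X]) = X + C 1 := by simp
    rw [e1, e2, e3, leadingCoeff_mul, leadingCoeff_mul, leadingCoeff_mul, leadingCoeff_X_add_C,
      leadingCoeff_X_add_C, leadingCoeff_C, F_leadingCoeff (by omega), one_mul, mul_one] at hl
    have hne : (X + 1 : (ZMod 2)[X]) ≠ 0 := (monic_X_add_C (1 : ZMod 2)).ne_zero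
    exact mul_left_cancel₀ hne (hl.trans (mul_one _).symm)
  have hgK : (C X + X) * (C X + 1) * (X + 1) * g0.map (bc K) = F K (2 ^ t * m) := by
    have := congrArg (Polynomial.map (bc K)) hg
    simpa [F, Polynomial.map_mul] using this
  have hGm := hgm.map (bc K)
  have hdeg := (infinity hk (by omega) hGm monic_one (by rw [mul_one]; exact hgK)).1
  rw [natDegree_one] at hdeg
  obtain ⟨h, hh, hirr, hd⟩ := exists_monic_irr hGm (by omega)
  obtain ⟨r, hr0, hprod⟩ := orbit hgm hirr0 hh hirr hd
  by_cases hr1 : r = 1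
  · subst hr1
    rw [hprod]; simpa using hirr
  exfalso
  have hP := iter_props hh hirr
  set j := r / 2 with hj
  have hsplit : g0.map (bc K) = (∏ i ∈ Finset.range j, (σ K)^[i] h) *
      ∏ i ∈ Finset.range (r - j), (σ K)^[j + i] h := by
    rw [hprod, ← Finset.prod_range_add]
    congr 2; omega
  set u := ∏ i ∈ Finset.range j, (σ K)^[i] h with hu
  set v := ∏ i ∈ Finset.range (r - j), (σ K)^[j + i] h with hv
  have hum : u.Monic := monic_prod_of_monic _ _ fun i _ => (hP i).1
  have hvm : v.Monic := monic_prod_of_monic _ _ fun i _ => (hP _).1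
  have hun : u.natDegree = j * h.natDegree := by
    rw [hu, natDegree_prod_of_monic _ _ fun i _ => (hP i).1,
      Finset.sum_congr rfl fun i _ => (hP i).2.2.1]
    simp
  have hvn : v.natDegree = (r - j) * h.natDegree := by
    rw [hv, natDegree_prod_of_monic _ _ fun i _ => (hP _).1,
      Finset.sum_congr rfl fun i _ => (hP _).2.2.1]
    simp
  have hus := ord_prod (Finset.range j) (fun i => (σ K)^[i] h) (fun i _ => (hP i).1) _
    (fun i _ => (hP i).2.2.2)
  have hvs := ord_prod (Finset.range (r - j)) (fun i => (σ K)^[j + i] h) (fun i _ => (hP _).1) _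
    (fun i _ => (hP _).2.2.2)
  rw [Finset.card_range] at hus hvs
  rw [hsplit] at hgK
  have hG := geometric ht hm hum hvm hgK
  have hO := ord_one ht hm hum hvm hgK
  have hI := (infinity hk (by omega) hum hvm hgK).1
  rw [hun, hvn, hus, hvs] at hG
  rw [hus, hvs] at hO
  rw [hun, hvn] at hI
  have hjr : j + (r - j) = r := by omega
  refine numeric ht hm hm3 hk6 (by omega) hj ?_ ?_ hG
  · rw [← hI, ← add_mul, hjr]
  · rw [← hO, ← add_mul, hjr]

end

theorem transfer {k : ℕ} (hk_even : Even k) (hk_pos : 0 < k) (hk6 : k ≠ 6) (hk2 : ∀ i : ℕ, k ≠ 2 ^ i)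
    (g : MvPolynomial (Fin 2) (ZMod 2))
    (hg : (MvPolynomial.X 0 + MvPolynomial.X 1) * (MvPolynomial.X 0 + 1) * (MvPolynomial.X 1 + 1) * g =
        MvPolynomial.X 0 * MvPolynomial.X 1 ^ k + MvPolynomial.X 1 * MvPolynomial.X 0 ^ k +
          MvPolynomial.X 0 ^ k + MvPolynomial.X 1 ^ k + MvPolynomial.X 0 + MvPolynomial.X 1)
    (hirr : Irreducible g) :
    Irreducible (MvPolynomial.map (algebraMap (ZMod 2) (AlgebraicClosure (ZMod 2))) g) := by
  have : CharP (AlgebraicClosure (ZMod 2)) 2 := charP_of_injective_algebraMap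
    (algebraMap (ZMod 2) (AlgebraicClosure (ZMod 2))).injective 2
  obtain ⟨t, m, hm, rfl⟩ := Nat.exists_eq_two_pow_mul_odd hk_pos.ne'
  have ht : t ≠ 0 := by
    rintro rfl
    rw [pow_zero, one_mul] at hk_even
    exact (Nat.not_even_iff_odd.2 hm) hk_even
  have hm3 : 3 ≤ m := by
    have h1 : m ≠ 1 := by rintro rfl; exact hk2 t (mul_one _)
    obtain ⟨c, rfl⟩ := hm
    omega
  let e := Polynomial.Bivariate.equivMvPolynomial (ZMod 2)
  have hg0 := congrArg e.symm hg
  have hirr0 : Irreducible (e.symm g) := (MulEquiv.irreducible_iff e.symm).2 hirr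
  have h2 : (2 : (ZMod 2)[X][X]) = 0 := CharTwo.two_eq_zero
  simp only [e, map_mul, map_add, map_pow, map_one, Polynomial.Bivariate.equivMvPolynomial_symm_X_0,
    Polynomial.Bivariate.equivMvPolynomial_symm_X_1] at hg0
  have hfin := main_bi (K := AlgebraicClosure (ZMod 2)) ht hm hm3 hk6 hirr0 (by
    rw [hg0, F]
    linear_combination -h2)
  rw [← MulEquiv.irreducible_iff (Polynomial.Bivariate.equivMvPolynomial (AlgebraicClosure (ZMod 2)))]
    at hfin
  convert hfin using 1
  have hcomm : ∀ p : (ZMod 2)[X][X],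
      MvPolynomial.map (algebraMap (ZMod 2) (AlgebraicClosure (ZMod 2))) (e p) =
      Polynomial.Bivariate.equivMvPolynomial (AlgebraicClosure (ZMod 2)) (p.map (bc _)) := by
    intro p
    induction p using Polynomial.induction_on' with
    | add p r hp hr => rw [map_add, map_add, hp, hr, Polynomial.map_add, map_add]
    | monomial j a =>
      induction a using Polynomial.induction_on' with
      | add p r hp hr => 
        rw [map_add, map_add, map_add, hp, hr, Polynomial.map_add, map_add]
      | monomial i c =>
        rw [← C_mul_X_pow_eq_monomial, ← C_mul_X_pow_eq_monomial]
        simp [e, Polynomial.map_mul]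
  rw [← hcomm]
  simp [e]

end GK


open MvPolynomial

/-- For `k` even and positive with `k ≠ 6` and `k` not a power of 2, if the
polynomial `g_k ∈ 𝔽₂[x,y]` of degree `k-2` with
`(x+y)(x+1)(y+1)·g_k = x·y^k + y·x^k + x^k + y^k + x + y` is irreducible in `𝔽₂[x,y]`,
then it is absolutely irreducible, i.e. irreducible over the algebraic closure of `𝔽₂`. -/
theorem g_absolutely_irreducible_of_irreducible
    (k : ℕ) (hk_even : Even k) (hk_pos : 0 < k) (hk6 : k ≠ 6) (hk2 : ∀ i : ℕ, k ≠ 2 ^ i)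
    (g : MvPolynomial (Fin 2) (ZMod 2)) (hdeg : g.totalDegree = k - 2)
    (hg : (X 0 + X 1) * (X 0 + 1) * (X 1 + 1) * g =
        X 0 * X 1 ^ k + X 1 * X 0 ^ k + X 0 ^ k + X 1 ^ k + X 0 + X 1)
    (hirr : Irreducible g) :
    Irreducible (MvPolynomial.map (algebraMap (ZMod 2) (AlgebraicClosure (ZMod 2))) g) := by
  exact GK.transfer hk_even hk_pos hk6 hk2 g hg hirr
end

section
/- (Segre–Bartocci conjecture) Let k be an even positive integer with k ≠ 6 and k not a power of 2, and let g_k(x,y) ∈ 𝔽₂[x,y] be the polynomial of degree k−2 with (x+y)(x+1)(y+1)·g_k(x,y) = x·y^k + y·x^k + x^k + y^k + x + y. Then g_k(x,y) has a factor in 𝔽₂[x,y] that is absolutely irreducible, i.e., there exists h ∈ 𝔽₂[x,y] dividing g_k such that h is irreducible as an element of K[x,y] for K an algebraic closure of 𝔽₂. -/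
/-- Number with binary support `D`. -/
def sbVal (D : Finset ℕ) : ℕ := ∑ i ∈ D, 2 ^ i

/-- Walks of length `t` between carries in the carry graph of multiplication by `n`. -/
def sbW (n c t c' : ℕ) : Prop := ∃ D O : Finset ℕ, D ⊆ Finset.range t ∧ O ⊆ Finset.range t ∧
  Disjoint D O ∧ n * sbVal D + c = 2 ^ t * c' + sbVal O

lemma sbVal_map (D : Finset ℕ) (t : ℕ) : sbVal (D.map (addRightEmbedding t)) = 2 ^ t * sbVal D := by
  simp only [sbVal, Finset.mul_sum, Finset.sum_map, addRightEmbedding_apply]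
  exact Finset.sum_congr rfl fun i _ => by rw [pow_add, mul_comm]

lemma sbW_refl (n c : ℕ) : sbW n c 0 c := ⟨∅, ∅, by simp, by simp, by simp, by simp [sbVal]⟩

lemma sb_disj {A B : Finset ℕ} {t : ℕ} (hA : A ⊆ Finset.range t) :
    Disjoint A (B.map (addRightEmbedding t)) := by
  rw [Finset.disjoint_left]
  intro a ha hb
  have := Finset.mem_range.1 (hA ha)
  simp only [Finset.mem_map, addRightEmbedding_apply] at hb
  obtain ⟨b, _, rfl⟩ := hb
  omega

lemma sb_sub {A B : Finset ℕ} {s t : ℕ} (hA : A ⊆ Finset.range s) (hB : B ⊆ Finset.range t) :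
    A ∪ B.map (addRightEmbedding s) ⊆ Finset.range (s + t) := by
  intro a ha
  rw [Finset.mem_union] at ha
  rw [Finset.mem_range]
  rcases ha with ha | ha
  · have := Finset.mem_range.1 (hA ha); omega
  · simp only [Finset.mem_map, addRightEmbedding_apply] at ha
    obtain ⟨b, hb, rfl⟩ := ha
    have := Finset.mem_range.1 (hB hb); omega

lemma sbW_trans {n a s b t c : ℕ} (h1 : sbW n a s b) (h2 : sbW n b t c) : sbW n a (s + t) c := by
  obtain ⟨D1, O1, hD1, hO1, hd1, e1⟩ := h1
  obtain ⟨D2, O2, hD2, hO2, hd2, e2⟩ := h2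
  refine ⟨D1 ∪ D2.map (addRightEmbedding s), O1 ∪ O2.map (addRightEmbedding s),
    sb_sub hD1 hD2, sb_sub hO1 hO2, ?_, ?_⟩
  · rw [Finset.disjoint_union_left, Finset.disjoint_union_right, Finset.disjoint_union_right]
    refine ⟨⟨hd1, sb_disj hD1⟩, (sb_disj hO1).symm, ?_⟩
    rwa [Finset.disjoint_map]
  · have u1 : sbVal (D1 ∪ D2.map (addRightEmbedding s)) = sbVal D1 + 2 ^ s * sbVal D2 := by
      rw [← sbVal_map, sbVal, Finset.sum_union (sb_disj hD1)]; rfl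
    have u2 : sbVal (O1 ∪ O2.map (addRightEmbedding s)) = sbVal O1 + 2 ^ s * sbVal O2 := by
      rw [← sbVal_map, sbVal, Finset.sum_union (sb_disj hO1)]; rfl
    rw [u1, u2, pow_add]
    linear_combination e1 + 2 ^ s * e2

lemma sbW_half (n c : ℕ) : sbW n c 1 (c / 2) := by
  rcases Nat.mod_two_eq_zero_or_one c with h | h
  · exact ⟨∅, ∅, by simp, by simp, by simp, by simp [sbVal]; omega⟩
  · exact ⟨∅, {0}, by simp, by simp, by simp, by simp [sbVal]; omega⟩

lemma sbW_zero (n c s : ℕ) : sbW n c s (c / 2 ^ s) := by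
  induction s with
  | zero => simpa using sbW_refl n c
  | succ s ih =>
    have := sbW_trans ih (sbW_half n _)
    rwa [Nat.div_div_eq_div_mul, ← pow_succ] at this

lemma sbW_one (k a s c : ℕ) (hk : Even k) (hk0 : 0 < k) (hs : 1 ≤ s)
    (hc : (k + 2 * a) / 2 ^ s = c) : sbW (k - 1) (2 * a + 1) s c := by
  obtain ⟨s, rfl⟩ := Nat.exists_eq_add_of_le hs
  have h1 : sbW (k - 1) (2 * a + 1) 1 ((k + 2 * a) / 2) :=
    ⟨{0}, ∅, by simp, by simp, by simp, by
      obtain ⟨r, rfl⟩ := hk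
      simp [sbVal]; omega⟩
  have := sbW_trans h1 (sbW_zero _ _ s)
  rw [Nat.div_div_eq_div_mul] at this
  rwa [← hc, pow_add, pow_one]

lemma sbW_mul {n c t : ℕ} (h : sbW n c t c) (N : ℕ) : sbW n c (N * t) c := by
  induction N with
  | zero => simpa using sbW_refl n c
  | succ N ih => rw [add_mul, one_mul]; exact sbW_trans ih h

lemma sb_div {x y c : ℕ} (h1 : c * y ≤ x) (h2 : x < (c + 1) * y) : x / y = c :=
  Nat.div_eq_of_lt_le h1 h2

theorem sb_walk (k : ℕ) (hk : Even k) (hk0 : 0 < k) (hk6 : k ≠ 6) (hk2 : ∀ i : ℕ, k ≠ 2 ^ i)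
    (N : ℕ) (hN : 0 < N) : ∃ t, sbW (k - 1) 1 (1 + N * t) 1 := by
  obtain ⟨N, rfl⟩ : ∃ M, N = M + 1 := ⟨N - 1, by omega⟩
  obtain ⟨L, hL⟩ : ∃ L, L = Nat.log 2 k := ⟨_, rfl⟩
  have hlo : 2 ^ L ≤ k := by rw [hL]; exact Nat.pow_log_le_self 2 hk0.ne'
  have hhi : k < 2 ^ (L + 1) := by rw [hL]; exact Nat.lt_pow_succ_log_self (by norm_num) k
  have hne := hk2 L
  have hpow : 2 ^ (L + 1) = 2 * 2 ^ L := by ring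
  have hL2 : 2 ≤ L := by
    by_contra h
    have : L = 0 ∨ L = 1 := by omega
    obtain ⟨r, rfl⟩ := hk
    rcases this with rfl | rfl <;> simp at * <;> omega
  have hone : ∀ s c, 1 ≤ s → k / 2 ^ s = c → sbW (k - 1) 1 s c := by
    intro s c hs hc
    simpa using sbW_one k 0 s c hk hk0 hs (by simpa using hc)
  have cA : sbW (k - 1) 1 L 1 := hone L 1 (by omega) (sb_div (by omega) (by omega))
  obtain ⟨r, hr⟩ : ∃ r, k = 2 ^ L + r := ⟨k - 2 ^ L, by omega⟩
  have hr0 : r ≠ 0 := by omega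
  obtain ⟨e, he⟩ : ∃ e, e = Nat.log 2 r := ⟨_, rfl⟩
  have helo : 2 ^ e ≤ r := by rw [he]; exact Nat.pow_log_le_self 2 hr0
  have hehi : r < 2 ^ (e + 1) := by rw [he]; exact Nat.lt_pow_succ_log_self (by norm_num) r
  have hpe : 2 ^ (e + 1) = 2 * 2 ^ e := by ring
  have heL : e < L := (Nat.pow_lt_pow_iff_right (by norm_num : 1 < 2)).1 (by omega : 2 ^ e < 2 ^ L)
  have he1 : 1 ≤ e := by
    by_contra h
    have : e = 0 := by omega
    subst this
    obtain ⟨M, rfl⟩ : ∃ M, L = M + 1 := ⟨L - 1, by omega⟩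
    obtain ⟨s, hs⟩ := hk
    rw [pow_succ] at hr
    simp at hehi
    omega
  obtain ⟨j, rfl⟩ : ∃ j, L = e + j := ⟨L - e, by omega⟩
  have hj1 : 1 ≤ j := by omega
  have cB : ∀ {L}, 1 ≤ L → sbW (k - 1) 1 L 1 → sbW (k - 1) 1 (2 * L - 1) 1 →
      ∃ t, sbW (k - 1) 1 (1 + (N + 1) * t) 1 := by
    intro L h h1 h2
    refine ⟨2 * L - 1, ?_⟩
    have := sbW_trans (sbW_mul h1 2) (sbW_mul h2 N)
    convert this using 1
    obtain ⟨M, rfl⟩ : ∃ M, L = M + 1 := ⟨L - 1, by omega⟩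
    rw [show 2 * (M + 1) - 1 = 2 * M + 1 by omega]
    ring
  have hej : 2 ^ (e + j) = 2 ^ e * 2 ^ j := pow_add _ _ _
  by_cases hj : j = 1
  · subst hj
    have h3 : sbW (k - 1) 1 e 3 := hone e 3 he1 (sb_div (by omega) (by omega))
    by_cases hc : k + 2 < 2 ^ (e + 1 + 1)
    · have h4 : sbW (k - 1) 3 (e + 1) 1 :=
        sbW_one k 1 (e + 1) 1 hk hk0 (by omega) (sb_div (by omega) (by omega))
      have := sbW_trans h3 h4
      refine cB (by omega) cA ?_
      convert this using 1; omega
    · have hk' : k + 2 = 2 ^ (e + 1 + 1) := by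
        obtain ⟨s, hs⟩ := hk
        omega
      have he2 : 2 ≤ e := by
        by_contra h
        have : e = 1 := by omega
        subst this
        norm_num at hk'
        omega
      obtain ⟨e, rfl⟩ : ∃ e', e = e' + 1 := ⟨e - 1, by omega⟩
      have hp4 : 2 ^ (e + 1) = 2 * 2 ^ e := by ring
      have : 2 ^ 1 ≤ 2 ^ e := Nat.pow_le_pow_right (by norm_num) (by omega)
      have h7 : sbW (k - 1) 1 e 7 := hone e 7 (by omega) (sb_div (by omega) (by omega))
      have h4 : sbW (k - 1) 7 (e + 1 + 1 + 1) 1 :=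
        sbW_one k 3 (e + 1 + 1 + 1) 1 hk hk0 (by omega) (by
          have : 2 ^ (e + 1 + 1 + 1) = 2 * 2 ^ (e + 1 + 1) := by ring
          exact sb_div (by omega) (by omega))
      have := sbW_trans h7 h4
      refine cB (by omega) cA ?_
      convert this using 1; omega
  · obtain ⟨i, rfl⟩ : ∃ i, j = i + 1 := ⟨j - 1, by omega⟩
    have hi : 1 ≤ i := by omega
    obtain ⟨i', hi'⟩ : ∃ i', i = i' + 1 := ⟨i - 1, by omega⟩
    obtain ⟨e', he'⟩ : ∃ e', e = e' + 1 := ⟨e - 1, by omega⟩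
    have pi : 2 ^ i = 2 * 2 ^ i' := by rw [hi']; ring
    have pe : 2 ^ e = 2 * 2 ^ e' := by rw [he']; ring
    have pj : 2 ^ (i + 1) = 2 * 2 ^ i := by ring
    have hprod : 2 ^ (e + (i + 1)) = 4 * (2 ^ e * 2 ^ i') := by rw [hej, pj, pi]; ring
    have b1 : 2 ^ e ≤ 2 ^ e * 2 ^ i' := Nat.le_mul_of_pos_right _ (by positivity)
    have b2 : 2 * 2 ^ i' ≤ 2 ^ e * 2 ^ i' := Nat.mul_le_mul_right _ (by
      have : 1 ≤ 2 ^ e' := Nat.one_le_two_pow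
      omega)
    have hp : sbW (k - 1) 1 e (2 ^ (i + 1) + 1) := hone e _ he1
      (sb_div (by rw [add_mul, one_mul, mul_comm, ← pow_add]; omega)
        (by rw [add_mul, add_mul, one_mul, mul_comm, ← pow_add]; omega))
    have hq : sbW (k - 1) (2 ^ i + 1) (e + (i + 1)) 1 := by
      rw [pi]
      exact sbW_one k _ _ 1 hk hk0 (by omega) (sb_div (by omega) (by omega))
    -- from `2a+1` to `2^i+1`
    have hmid : ∀ a, 2 * a ≤ k / 2 ^ (i + 1) → k / 2 ^ (i + 1) ≤ 2 * a + 1 →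
        sbW (k - 1) (2 * a + 1) (e + 1) (2 ^ i + 1) := by
      intro a ha1 ha2
      have q1 : 2 ^ e ≤ k / 2 ^ (i + 1) := by
        rw [Nat.le_div_iff_mul_le (by positivity), ← hej]; omega
      have q2 : k / 2 ^ (i + 1) < 2 * 2 ^ e := by
        rw [Nat.div_lt_iff_lt_mul (by positivity), mul_assoc, ← hej]; omega
      refine sbW_one k _ _ _ hk hk0 (by omega) (sb_div ?_ ?_)
      · rw [add_mul, one_mul, mul_comm (2 ^ i), ← pow_add, hpe,
          show 2 ^ (e + 1 + i) = 2 ^ (e + (i + 1)) by ring]; omega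
      · rw [add_mul, add_mul, one_mul, mul_comm (2 ^ i), ← pow_add, hpe,
          show 2 ^ (e + 1 + i) = 2 ^ (e + (i + 1)) by ring]; omega
    rcases Nat.even_or_odd' (k / 2 ^ (i + 1)) with ⟨a, ha | ha⟩
    · have hp' : sbW (k - 1) (2 ^ (i + 1) + 1) (i + 1) (2 * a + 1) := by
        rw [pj]
        refine sbW_one k _ _ _ hk hk0 (by omega) ?_
        rw [← ha, ← pj, Nat.add_div_right _ (by positivity)]
      have hpp : sbW (k - 1) (2 ^ (i + 1) + 1) (e + (i + 1)) 1 := by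
        rw [pj]
        exact sbW_one k _ _ _ hk hk0 (by omega) (sb_div (by omega) (by omega))
      have c1 := sbW_trans hp hpp
      have c2 := sbW_trans (sbW_trans (sbW_trans hp hp') (hmid a (by omega) (by omega))) hq
      have := sbW_trans (sbW_trans c2 (sbW_mul c1 N)) (sbW_mul cA N)
      refine ⟨2 * (e + (i + 1)) + e, ?_⟩
      convert this using 1
      ring
    · have c2 := sbW_trans (sbW_trans (hone (i + 1) _ (by omega) ha)
        (hmid a (by omega) (by omega))) hq
      have := sbW_trans c2 (sbW_mul cA (2 * N))
      refine ⟨2 * (e + (i + 1)), ?_⟩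
      convert this using 1
      ring
lemma sbVal_range (m : ℕ) : sbVal (Finset.range m) + 1 = 2 ^ m := by
  have := Nat.geomSum_eq (le_refl 2) m
  have h2 : 1 ≤ 2 ^ m := Nat.one_le_two_pow
  simp only [sbVal]
  rw [this]
  simp
  omega

lemma sbVal_sdiff {A B : Finset ℕ} (h : B ⊆ A) : sbVal (A \ B) + sbVal B = sbVal A :=
  Finset.sum_sdiff h

lemma sbVal_mono {A B : Finset ℕ} (h : B ⊆ A) : sbVal B ≤ sbVal A := by
  rw [← sbVal_sdiff h]; omega

lemma sbVal_pos {A : Finset ℕ} (h : A.Nonempty) : 0 < sbVal A :=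
  Finset.sum_pos (fun i _ => by positivity) h

lemma sbVal_inj {A B : Finset ℕ} (h : sbVal A = sbVal B) : A = B :=
  Finset.geomSum_injective (le_refl 2) h

/-- Solutions `D` of the Glynn-type condition. -/
def sbGood (k m : ℕ) (D : Finset ℕ) : Prop := D ⊆ Finset.range m ∧ D.Nonempty ∧
  ∃ A, A ⊆ Finset.range m \ D ∧ (2 ^ m - 1) ∣ sbVal A + k * sbVal D

lemma sb_expand {F : Type*} [Field F] [CharP F 2] (y : F) (D : Finset ℕ) :
    (y + 1) ^ sbVal D = ∑ T ∈ D.powerset, y ^ sbVal T := by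
  have : Fact (Nat.Prime 2) := ⟨Nat.prime_two⟩
  rw [sbVal, ← Finset.prod_pow_eq_pow_sum]
  simp_rw [add_pow_char_pow, one_pow]
  rw [Finset.prod_add_one]
  exact Finset.sum_congr rfl fun T _ => by rw [sbVal, Finset.prod_pow_eq_pow_sum]

lemma sb_sum_pow {F : Type*} [Field F] [Fintype F] [CharP F 2] (s : ℕ) (h : s ≠ 0)
    (hd : Fintype.card F - 1 ∣ s) : ∑ x : F, x ^ s = 1 := by
  classical
  have h1 := FiniteField.sum_pow_units F s
  rw [if_pos hd] at h1
  rw [CharTwo.neg_eq] at h1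
  rw [← h1, Fintype.sum_eq_add_sum_compl 0, zero_pow h, zero_add]
  symm
  refine Finset.sum_bij (fun (x : Fˣ) _ => (x : F)) ?_ ?_ ?_ ?_
  · intro x _; simp
  · intro x _ y _ h; exact Units.ext h
  · intro b hb
    have : b ≠ 0 := by simpa using hb
    exact ⟨Units.mk0 b this, Finset.mem_univ _, rfl⟩
  · intro x _; simp

lemma sb_sum_pow' {F : Type*} [Field F] [Fintype F] [CharP F 2] (s : ℕ)
    (hd : ¬ (s ≠ 0 ∧ Fintype.card F - 1 ∣ s)) : ∑ x : F, x ^ s = 0 := by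
  classical
  by_cases h : s = 0
  · subst h
    simp
  have hd : ¬ Fintype.card F - 1 ∣ s := fun h' => hd ⟨h, h'⟩
  have h1 := FiniteField.sum_pow_units F s
  rw [if_neg hd] at h1
  rw [← h1, Fintype.sum_eq_add_sum_compl 0, zero_pow h, zero_add]
  symm
  refine Finset.sum_bij (fun (x : Fˣ) _ => (x : F)) ?_ ?_ ?_ ?_
  · intro x _; simp
  · intro x _ y _ h; exact Units.ext h
  · intro b hb
    have : b ≠ 0 := by simpa using hb
    exact ⟨Units.mk0 b this, Finset.mem_univ _, rfl⟩
  · intro x _; simp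

lemma sbGood_of_walk {k m : ℕ} (hk : 2 < k) (hm : 0 < m) (h : sbW (k - 1) 1 m 1) :
    ∃ D, sbGood k m D ∧ D.card < m := by
  obtain ⟨D, O, hD, hO, hd, he⟩ := h
  have hr := sbVal_range m
  have h2 : 2 ^ 1 ≤ 2 ^ m := Nat.pow_le_pow_right (by norm_num) hm
  obtain ⟨n, rfl⟩ : ∃ n, k = n + 1 := ⟨k - 1, by omega⟩
  simp only [Nat.add_sub_cancel, mul_one] at he
  have hu : D ∪ O ⊆ Finset.range m := Finset.union_subset hD hO
  have hA := sbVal_sdiff hu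
  have hDO : sbVal (D ∪ O) = sbVal D + sbVal O := Finset.sum_union hd
  refine ⟨D, ⟨hD, ?_, Finset.range m \ (D ∪ O), ?_, ⟨2, ?_⟩⟩, ?_⟩
  · rw [Finset.nonempty_iff_ne_empty]
    rintro rfl
    simp [sbVal] at he
    omega
  · exact Finset.sdiff_subset_sdiff (le_refl _) Finset.subset_union_left
  · rw [add_mul]; omega
  · have hle := Finset.card_le_card hD
    rw [Finset.card_range] at hle
    refine lt_of_le_of_ne hle fun hc => ?_
    have hDr : D = Finset.range m := Finset.eq_of_subset_of_card_le hD (by simp [hc])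
    have hO0 : O = ∅ := by
      rw [hDr] at hd
      rw [← Finset.subset_empty]
      intro x hx
      exact absurd hx (Finset.disjoint_left.1 hd (hO hx))
    subst hO0
    have h0 : sbVal ∅ = 0 := by simp [sbVal]
    rw [h0] at he
    have : 2 * sbVal D ≤ n * sbVal D := Nat.mul_le_mul_right _ (by omega)
    rw [hDr] at he this
    omega

theorem sb_perm {F : Type*} [Field F] [Fintype F] [CharP F 2] {k m : ℕ} (hm : 0 < m)
    (hcard : Fintype.card F = 2 ^ m) (hk : 2 < k)
    (hinj : Function.Injective fun x : F => (x ^ k + 1) / (x + 1))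
    (h : sbW (k - 1) 1 m 1) : False := by
  classical
  obtain ⟨D0, hD0, hc0⟩ := sbGood_of_walk hk hm h
  have hex : ∃ c, ∃ D, sbGood k m D ∧ D.card = c := ⟨_, D0, hD0, rfl⟩
  obtain ⟨D, hD, hDc⟩ := Nat.find_spec hex
  have hmin : ∀ B, sbGood k m B → D.card ≤ B.card := fun B hB => by
    rw [hDc]; exact Nat.find_min' hex ⟨B, hB, rfl⟩
  have hDm : D.card < m := lt_of_le_of_lt (hmin D0 hD0) hc0
  obtain ⟨hDr, hDn, A0, hA0, hdvd⟩ := hD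
  have hr := sbVal_range m
  have hsd := sbVal_sdiff hDr
  have hDpos := sbVal_pos hDn
  have hco : 0 < sbVal (Finset.range m \ D) := sbVal_pos (by
    rw [Finset.sdiff_nonempty]
    intro hle
    have := Finset.card_le_card hle
    simp at this
    omega)
  -- the power sum vanishes
  have hbij : Function.Bijective fun x : F => (x ^ k + 1) / (x + 1) :=
    Finite.injective_iff_bijective.1 hinj
  have hz : ∑ x : F, ((x ^ k + 1) / (x + 1)) ^ sbVal D = 0 := by
    rw [hbij.sum_comp (fun y => y ^ sbVal D)]
    exact FiniteField.sum_pow_lt_card_sub_one F _ (by rw [hcard]; omega)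
  have hterm : ∀ x : F, ((x ^ k + 1) / (x + 1)) ^ sbVal D =
      (x + 1) ^ sbVal (Finset.range m \ D) * (x ^ k + 1) ^ sbVal D := by
    intro x
    by_cases hx : x + 1 = 0
    · simp [hx, hco.ne', hDpos.ne']
    · have : (x + 1) ^ sbVal (Finset.range m \ D) * (x + 1) ^ sbVal D = 1 := by
        rw [← pow_add, hsd, show sbVal (Finset.range m) = Fintype.card F - 1 by omega]
        exact FiniteField.pow_card_sub_one_eq_one _ hx
      rw [div_pow, div_eq_iff (pow_ne_zero _ hx)]
      linear_combination -(x ^ k + 1) ^ sbVal D * this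
  simp_rw [hterm, sb_expand, Finset.sum_mul_sum, ← pow_mul, ← pow_add] at hz
  rw [Finset.sum_comm] at hz
  simp_rw [Finset.sum_comm (s := Finset.univ)] at hz
  have hlt : ∀ A, A ⊆ Finset.range m \ D → sbVal A < 2 ^ m - 1 := fun A hA => by
    have := sbVal_mono hA; omega
  have hkey : ∀ A ∈ (Finset.range m \ D).powerset, ∀ B ∈ D.powerset,
      (sbVal A + k * sbVal B ≠ 0 ∧ Fintype.card F - 1 ∣ sbVal A + k * sbVal B) → A = A0 ∧ B = D := by
    intro A hA B hB ⟨hne, hd⟩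
    rw [Finset.mem_powerset] at hA hB
    rw [hcard] at hd
    rcases B.eq_empty_or_nonempty with rfl | hBn
    · have h0 : sbVal ∅ = 0 := by simp [sbVal]
      rw [h0] at hne hd
      have := Nat.le_of_dvd (by omega) hd
      have := hlt A hA
      omega
    · have hBD : B = D := Finset.eq_of_subset_of_card_le hB (hmin B ⟨hB.trans hDr, hBn, A,
        hA.trans (Finset.sdiff_subset_sdiff (le_refl _) hB), hd⟩)
      refine ⟨?_, hBD⟩
      subst hBD
      apply sbVal_inj
      have h1 : sbVal A + k * sbVal B ≡ sbVal A0 + k * sbVal B [MOD (2 ^ m - 1)] :=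
        ((Nat.modEq_zero_iff_dvd).2 hd).trans ((Nat.modEq_zero_iff_dvd).2 hdvd).symm
      exact Nat.ModEq.eq_of_lt_of_lt (Nat.ModEq.add_right_cancel' _ h1) (hlt A hA) (hlt A0 hA0)
  rw [Finset.sum_eq_single A0] at hz
  · rw [Finset.sum_eq_single D] at hz
    · rw [sb_sum_pow] at hz
      · exact one_ne_zero hz
      · have : 0 < k * sbVal D := by positivity
        omega
      · rwa [hcard]
    · intro B hB hne
      exact sb_sum_pow' _ fun h => hne (hkey A0 (by simpa using hA0) B hB h).2
    · intro h; simp at h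
  · intro A hA hne
    exact Finset.sum_eq_zero fun B hB => sb_sum_pow' _ fun h => hne (hkey A hA B hB h).1
  · intro h; exact absurd (Finset.mem_powerset.2 hA0) h

open MvPolynomial


lemma sb_fin1 (c : AlgebraicClosure (ZMod 2)) : ∃ N, 0 < N ∧ c ^ 2 ^ N = c := by
  have hc : IsIntegral (ZMod 2) c := Algebra.IsIntegral.isIntegral c
  have : FiniteDimensional (ZMod 2) (IntermediateField.adjoin (ZMod 2) {c}) :=
    IntermediateField.adjoin.finiteDimensional hc
  have : Finite (IntermediateField.adjoin (ZMod 2) {c}) := Module.finite_of_finite (ZMod 2)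
  have := Fintype.ofFinite (IntermediateField.adjoin (ZMod 2) {c})
  obtain ⟨n, -, hn⟩ := FiniteField.card (IntermediateField.adjoin (ZMod 2) {c}) 2
  refine ⟨n, n.pos, ?_⟩
  have h := FiniteField.pow_card
    (⟨c, IntermediateField.mem_adjoin_simple_self _ _⟩ : IntermediateField.adjoin (ZMod 2) {c})
  rw [hn] at h
  exact congrArg Subtype.val h

lemma sb_iter {K : Type*} [Monoid K] {c : K} {N : ℕ} (h : c ^ 2 ^ N = c) (t : ℕ) :
    c ^ 2 ^ (N * t) = c := by
  induction t with
  | zero => simp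
  | succ t ih => rw [mul_add, mul_one, pow_add, pow_mul, ih, h]

lemma sb_fin (S : Finset (AlgebraicClosure (ZMod 2))) :
    ∃ N, 0 < N ∧ ∀ c ∈ S, c ^ 2 ^ N = c := by
  classical
  induction S using Finset.induction_on with
  | empty => exact ⟨1, one_pos, by simp⟩
  | insert a s _ ih =>
    obtain ⟨N, hN, h⟩ := ih
    obtain ⟨M, hM, h'⟩ := sb_fin1 a
    refine ⟨N * M, Nat.mul_pos hN hM, ?_⟩
    intro c hc
    rcases Finset.mem_insert.1 hc with rfl | hc
    · rw [mul_comm]; exact sb_iter h' N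
    · exact sb_iter (h c hc) M

lemma sb_desc (u : MvPolynomial (Fin 2) (AlgebraicClosure (ZMod 2)))
    (hu : map (frobenius (AlgebraicClosure (ZMod 2)) 2) u = u) :
    ∃ h, map (algebraMap (ZMod 2) (AlgebraicClosure (ZMod 2))) h = u := by
  refine mem_range_map_iff_coeffs_subset.2 ?_
  intro c hc
  rw [Finset.mem_coe, mem_coeffs_iff] at hc
  obtain ⟨s, _, rfl⟩ := hc
  have := congrArg (coeff s) hu
  rw [coeff_map, frobenius_def] at this
  have h2 : coeff s u * (coeff s u - 1) = 0 := by linear_combination this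
  rcases mul_eq_zero.1 h2 with h | h
  · exact ⟨0, by simp [h]⟩
  · exact ⟨1, by rw [map_one, ← sub_eq_zero.1 h]⟩

lemma sb_map_frob (h : MvPolynomial (Fin 2) (ZMod 2)) :
    map (frobenius (AlgebraicClosure (ZMod 2)) 2)
      (map (algebraMap (ZMod 2) (AlgebraicClosure (ZMod 2))) h) =
    map (algebraMap (ZMod 2) (AlgebraicClosure (ZMod 2))) h := by
  rw [map_map]
  congr 1
  congr 1
  exact Subsingleton.elim _ _

lemma sb_dvd_desc (h g : MvPolynomial (Fin 2) (ZMod 2)) (hh : h ≠ 0)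
    (hd : map (algebraMap (ZMod 2) (AlgebraicClosure (ZMod 2))) h ∣
      map (algebraMap (ZMod 2) (AlgebraicClosure (ZMod 2))) g) : h ∣ g := by
  have hinj := map_injective (σ := Fin 2) (algebraMap (ZMod 2) (AlgebraicClosure (ZMod 2)))
    (algebraMap (ZMod 2) (AlgebraicClosure (ZMod 2))).injective
  obtain ⟨q, hq⟩ := hd
  have h0 : map (algebraMap (ZMod 2) (AlgebraicClosure (ZMod 2))) h ≠ 0 :=
    fun h' => hh (hinj (by rw [h', map_zero]))
  have h1 := congrArg (map (frobenius (AlgebraicClosure (ZMod 2)) 2)) hq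
  rw [map_mul, sb_map_frob, sb_map_frob, hq] at h1
  obtain ⟨q', rfl⟩ := sb_desc q (mul_left_cancel₀ h0 h1).symm
  rw [← map_mul] at hq
  exact ⟨q', hinj hq⟩

/-- An irreducible `u` dividing its Frobenius conjugate is, up to a scalar, defined over `𝔽₂`. -/
lemma sb_scale (u : MvPolynomial (Fin 2) (AlgebraicClosure (ZMod 2))) (hu : Irreducible u)
    (hd : u ∣ map (frobenius (AlgebraicClosure (ZMod 2)) 2) u) :
    ∃ h, Associated (map (algebraMap (ZMod 2) (AlgebraicClosure (ZMod 2))) h) u := by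
  have hirr : Irreducible (map (frobenius (AlgebraicClosure (ZMod 2)) 2) u) := by
    have := (MulEquiv.irreducible_iff (mapEquiv (Fin 2)
      (frobeniusEquiv (AlgebraicClosure (ZMod 2)) 2))).2 hu
    exact this
  obtain ⟨c, hc⟩ := hd
  have hcu : IsUnit c := (hirr.isUnit_or_isUnit hc).resolve_left hu.not_isUnit
  obtain ⟨r, hr, rfl⟩ := isUnit_iff_eq_C_of_isReduced.1 hcu
  have hr0 := hr.ne_zero
  have hfix : map (frobenius (AlgebraicClosure (ZMod 2)) 2) (C r⁻¹ * u) = C r⁻¹ * u := by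
    rw [map_mul, map_C, hc, frobenius_def, mul_comm u, ← mul_assoc, ← C_mul]
    congr 2
    field_simp
  obtain ⟨h, hh⟩ := sb_desc _ hfix
  refine ⟨h, ?_⟩
  rw [hh]
  exact associated_unit_mul_left _ _ ((isUnit_iff_ne_zero.2 (inv_ne_zero hr0)).map C)

lemma sb_pderiv {K : Type*} [Field K] (p : Fin 2 → K) (u v w : MvPolynomial (Fin 2) K)
    (hu : eval p u = 0) (hv : eval p v = 0) (i : Fin 2) : eval p (pderiv i (u * v * w)) = 0 := by
  simp [Derivation.leibniz, hu, hv]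

theorem segre_bartocci
    (k : ℕ) (hk_even : Even k) (hk_pos : 0 < k) (hk6 : k ≠ 6) (hk2 : ∀ i : ℕ, k ≠ 2 ^ i)
    (g : MvPolynomial (Fin 2) (ZMod 2)) (hdeg : g.totalDegree = k - 2)
    (hg : (X 0 + X 1) * (X 0 + 1) * (X 1 + 1) * g =
        X 0 * X 1 ^ k + X 1 * X 0 ^ k + X 0 ^ k + X 1 ^ k + X 0 + X 1) :
    ∃ h : MvPolynomial (Fin 2) (ZMod 2), h ∣ g ∧
      Irreducible (MvPolynomial.map (algebraMap (ZMod 2) (AlgebraicClosure (ZMod 2))) h) := by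
  classical
  by_contra hno
  have hk : 2 < k := by
    have := hk2 1
    obtain ⟨r, rfl⟩ := hk_even
    omega
  have hg0 : g ≠ 0 := by
    rintro rfl
    rw [totalDegree_zero] at hdeg
    omega
  have hinj := map_injective (σ := Fin 2) (algebraMap (ZMod 2) (AlgebraicClosure (ZMod 2)))
    (algebraMap (ZMod 2) (AlgebraicClosure (ZMod 2))).injective
  obtain ⟨G, hG⟩ : ∃ G, G = map (algebraMap (ZMod 2) (AlgebraicClosure (ZMod 2))) g := ⟨_, rfl⟩
  have hG0 : G ≠ 0 := by
    rw [hG]; exact fun h' => hg0 (hinj (by rw [h', map_zero]))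
  have hGf : map (frobenius (AlgebraicClosure (ZMod 2)) 2) G = G := by
    rw [hG, sb_map_frob]
  have hGeq := congrArg (map (algebraMap (ZMod 2) (AlgebraicClosure (ZMod 2)))) hg
  simp only [map_mul, map_add, map_pow, map_X, map_one, ← hG] at hGeq
  obtain ⟨N, hN, hfix⟩ := sb_fin
    ((UniqueFactorizationMonoid.factors G).toFinset.biUnion (fun u => u.coeffs) ∪
      (Polynomial.nthRoots k (1 : AlgebraicClosure (ZMod 2))).toFinset)
  obtain ⟨t, ht⟩ := sb_walk k hk_even hk_pos hk6 hk2 N hN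
  have hfixm : ∀ c ∈ ((UniqueFactorizationMonoid.factors G).toFinset.biUnion (fun u => u.coeffs) ∪
      (Polynomial.nthRoots k (1 : AlgebraicClosure (ZMod 2))).toFinset),
      c ^ 2 ^ (1 + N * t) = c ^ 2 := by
    intro c hc
    rw [add_comm, pow_add, pow_mul, sb_iter (hfix c hc), pow_one]
  have hroot : ∀ c : AlgebraicClosure (ZMod 2), c ^ k = 1 → c ^ 2 ^ (1 + N * t) = c → c = 1 := by
    intro c hc hcm
    have h1 := hfixm c (Finset.mem_union_right _ (by
      rw [Multiset.mem_toFinset, Polynomial.mem_nthRoots hk_pos]; exact hc))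
    rw [hcm] at h1
    have hc0 : c ≠ 0 := by rintro rfl; simp [hk_pos.ne'] at hc
    have : c * (c - 1) = 0 := by linear_combination -h1
    exact sub_eq_zero.1 ((mul_eq_zero.1 this).resolve_left hc0)
  have hchar : (2 : MvPolynomial (Fin 2) (AlgebraicClosure (ZMod 2))) = 0 := CharTwo.two_eq_zero
  have hchar' : (2 : AlgebraicClosure (ZMod 2)) = 0 := CharTwo.two_eq_zero
  -- no rational points with distinct coordinates
  have hpts : ∀ a b : AlgebraicClosure (ZMod 2), a ^ 2 ^ (1 + N * t) = a →
      b ^ 2 ^ (1 + N * t) = b → a ≠ 1 → b ≠ 1 → (a ^ k + 1) * (b + 1) = (b ^ k + 1) * (a + 1) →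
      a = b := by
    intro a b ha hb ha1 hb1 hab
    by_contra hne
    have hGab : eval ![a, b] G = 0 := by
      have h1 := congrArg (eval ![a, b]) hGeq
      simp at h1
      have h2 : (a + b) * (a + 1) * (b + 1) * eval ![a, b] G = 0 := by
        rw [h1]; linear_combination hab + (b ^ k * a + b ^ k + a + 1 - 1) * hchar'
      have h3 : a + b ≠ 0 := fun h => hne (CharTwo.add_eq_zero.1 h)
      have h4 : a + 1 ≠ 0 := fun h => ha1 (CharTwo.add_eq_zero.1 h)
      have h5 : b + 1 ≠ 0 := fun h => hb1 (CharTwo.add_eq_zero.1 h)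
      simpa [h3, h4, h5] using h2
    obtain ⟨u, hu, hu0⟩ : ∃ u ∈ UniqueFactorizationMonoid.factors G, eval ![a, b] u = 0 := by
      obtain ⟨v, hv⟩ := UniqueFactorizationMonoid.factors_prod hG0
      have h1 := congrArg (eval ![a, b]) hv
      rw [hGab, map_mul] at h1
      have h2 : eval ![a, b] (v : MvPolynomial (Fin 2) (AlgebraicClosure (ZMod 2))) ≠ 0 :=
        (v.isUnit.map (eval ![a, b])).ne_zero
      have h3 := (mul_eq_zero.1 h1).resolve_right h2
      rw [map_multiset_prod, Multiset.prod_eq_zero_iff, Multiset.mem_map] at h3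
      exact h3
    have hirr := UniqueFactorizationMonoid.irreducible_of_factor u hu
    have hdvd : u ∣ G := UniqueFactorizationMonoid.dvd_of_mem_factors hu
    -- the Frobenius conjugate also vanishes at the point
    have hφ0 : eval ![a, b] (map (frobenius (AlgebraicClosure (ZMod 2)) 2) u) = 0 := by
      have h1 : map (frobenius (AlgebraicClosure (ZMod 2)) 2) u =
          map (iterateFrobenius (AlgebraicClosure (ZMod 2)) 2 (1 + N * t)) u := by
        ext s
        rw [coeff_map, coeff_map, frobenius_def, iterateFrobenius_def]
        by_cases hs : coeff s u = 0
        · rw [hs]; simp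
        · exact (hfixm _ (Finset.mem_union_left _ (Finset.mem_biUnion.2
            ⟨u, Multiset.mem_toFinset.2 hu, coeff_mem_coeffs s hs⟩))).symm
      have h2 := congrArg (iterateFrobenius (AlgebraicClosure (ZMod 2)) 2 (1 + N * t)) hu0
      rw [map_zero, eval, coe_eval₂Hom, eval₂_comp_left] at h2
      rw [h1, eval_map, ← h2]
      congr 1
      funext i
      fin_cases i <;> simp [iterateFrobenius_def, ha, hb]
    obtain ⟨w, hw⟩ : map (frobenius (AlgebraicClosure (ZMod 2)) 2) u ∣ G := by
      rw [← hGf]; exact map_dvd _ hdvd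
    rcases hirr.prime.dvd_or_dvd (hw ▸ hdvd) with hd | ⟨w', rfl⟩
    · obtain ⟨h, hh⟩ := sb_scale u hirr hd
      have hirr' := hh.irreducible_iff.2 hirr
      refine hno ⟨h, sb_dvd_desc h g ?_ ?_, hirr'⟩
      · rintro rfl; rw [map_zero] at hirr'; exact not_irreducible_zero hirr'
      · rw [← hG]; exact hh.dvd.trans hdvd
    · have h1 := congrArg (fun P => eval ![a, b] (pderiv 0 P)) hGeq
      rw [show (X 0 + X 1) * (X 0 + 1) * (X 1 + 1) * G =
        map (frobenius (AlgebraicClosure (ZMod 2)) 2) u * u *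
          (w' * ((X 0 + X 1) * (X 0 + 1) * (X 1 + 1))) by rw [hw]; ring,
        sb_pderiv _ _ _ _ hφ0 hu0] at h1
      have hk0 : (k : AlgebraicClosure (ZMod 2)) = 0 :=
        (CharP.cast_eq_zero_iff _ 2 k).2 hk_even.two_dvd
      simp [Derivation.leibniz, Derivation.leibniz_pow, pderiv_X, hk0] at h1
      exact hb1 (hroot b (CharTwo.add_eq_zero.1 (by rw [h1])) hb)
  -- so the rational function is a permutation
  have hm0 : 1 + N * t ≠ 0 := by omega
  let F := GaloisField 2 (1 + N * t)
  let _ : Fintype F := Fintype.ofFinite F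
  have hcard : Fintype.card F = 2 ^ (1 + N * t) := by
    rw [← Nat.card_eq_fintype_card]; exact GaloisField.card 2 _ hm0
  let ι : F →ₐ[ZMod 2] AlgebraicClosure (ZMod 2) := IsAlgClosed.lift
  have hι : Function.Injective ι := ι.toRingHom.injective
  have hFm : ∀ x : F, ι x ^ 2 ^ (1 + N * t) = ι x := by
    intro x
    rw [← map_pow, ← hcard, FiniteField.pow_card]
  have h11 : ∀ x : F, x ≠ 1 → x + 1 ≠ 0 := fun x hx h => hx (CharTwo.add_eq_zero.1 h)
  have hι1 : ∀ x : F, x ≠ 1 → ι x ≠ 1 := fun x hx h => hx (hι (by rw [h, map_one]))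
  have hone : ∀ y : F, y ≠ 1 → (y ^ k + 1) / (y + 1) ≠ 0 := by
    intro y hy h
    rw [div_eq_zero_iff] at h
    have h := h.resolve_right (h11 y hy)
    refine hι1 y hy (hroot (ι y) ?_ (hFm y))
    rw [← map_pow, CharTwo.add_eq_zero.1 h, map_one]
  have hp1 : ((1 : F) ^ k + 1) / (1 + 1) = 0 := by
    rw [one_pow, CharTwo.add_self_eq_zero, div_zero]
  refine sb_perm (F := F) (by omega) hcard hk ?_ ht
  intro x y hxy
  simp only at hxy
  by_cases hx : x = 1
  · by_cases hy : y = 1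
    · rw [hx, hy]
    · subst hx
      rw [hp1] at hxy
      exact absurd hxy.symm (hone y hy)
  · by_cases hy : y = 1
    · subst hy
      rw [hp1] at hxy
      exact absurd hxy (hone x hx)
    · rw [div_eq_div_iff (h11 x hx) (h11 y hy)] at hxy
      have := congrArg ι hxy
      simp only [map_mul, map_add, map_pow, map_one] at this
      exact hι (hpts _ _ (hFm x) (hFm y) (hι1 x hx) (hι1 y hy) this)
end
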